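/- Let f ∈ Λ_p, 1<p<∞, α₁,α₂>0, n₁,n₂ ∈ ℕ. Then ω_{α₁,α₂}(f, 1/n₁, 1/n₂)_p ≍ n₁^{−α₁} n₂^{−α₂} {Σ_{ν₁=1}^{n₁+1} Σ_{ν₂=1}^{n₂+1} ν₁^{2α₁−1} ν₂^{2α₂−1} Y_{ν₁−1,ν₂−1}(f)_p²}^{1/2}, with constants independent of f, n₁, n₂. -/

import Mathlib

open MeasureTheory Real
open scoped ENNReal

noncomputable section

/-- The `L_p` norm of a function of two variables over the period square `(0,2π]²`. -/
def Lp2Norm (p : ℝ) (f : ℝ → ℝ → ℝ) : ℝ≥0∞ :=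
  (∫⁻ x in Set.Ioc (0:ℝ) (2*π), ∫⁻ y in Set.Ioc (0:ℝ) (2*π),
      ENNReal.ofReal (|f x y| ^ p)) ^ (1/p)

/-- `f ∈ L_p^0(T²)`: measurable, `2π`-periodic in each variable, finite `L_p` norm,
and zero mean in each variable separately. -/
structure MemLp0 (p : ℝ) (f : ℝ → ℝ → ℝ) : Prop where
  meas : Measurable (Function.uncurry f)
  periodic_x : ∀ y, Function.Periodic (fun x => f x y) (2*π)
  periodic_y : ∀ x, Function.Periodic (f x) (2*π)
  norm_ne_top : Lp2Norm p f ≠ ⊤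
  mean_x : ∀ᵐ (y : ℝ) ∂volume, (∫ x in (0:ℝ)..(2*π), f x y) = 0
  mean_y : ∀ᵐ (x : ℝ) ∂volume, (∫ y in (0:ℝ)..(2*π), f x y) = 0

/-- Generalized (fractional) binomial coefficient `C(α,ν) = α(α-1)⋯(α-ν+1)/ν!`. -/
def fracBinom (α : ℝ) : ℕ → ℝ
  | 0 => 1
  | n+1 => fracBinom α n * (α - (n : ℝ)) / ((n : ℝ) + 1)

/-- Fractional difference of order `α` with step `h` in the first variable. -/
def diffX (α h : ℝ) (f : ℝ → ℝ → ℝ) : ℝ → ℝ → ℝ :=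
  fun x y => ∑' ν : ℕ, (-1 : ℝ) ^ ν * fracBinom α ν * f (x + (α - (ν : ℝ)) * h) y

/-- Fractional difference of order `α` with step `h` in the second variable. -/
def diffY (α h : ℝ) (f : ℝ → ℝ → ℝ) : ℝ → ℝ → ℝ :=
  fun x y => ∑' ν : ℕ, (-1 : ℝ) ^ ν * fracBinom α ν * f x (y + (α - (ν : ℝ)) * h)

/-- The mixed (fractional) modulus of smoothness `ω_{α₁,α₂}(f, δ₁, δ₂)_p`. -/
def mixedMod (p α₁ α₂ δ₁ δ₂ : ℝ) (f : ℝ → ℝ → ℝ) : ℝ≥0∞ :=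
  ⨆ (h₁ : ℝ) (_ : |h₁| ≤ δ₁) (h₂ : ℝ) (_ : |h₂| ≤ δ₂),
    Lp2Norm p (diffX α₁ h₁ (diffY α₂ h₂ f))

/-- `T` is (an `L_p(T²)` function which is) a trigonometric polynomial of degree
at most `m` in the first variable. -/
def TrigPolyX (p : ℝ) (m : ℕ) (T : ℝ → ℝ → ℝ) : Prop :=
  Measurable (Function.uncurry T) ∧ Lp2Norm p T ≠ ⊤ ∧
  (∀ x, Function.Periodic (T x) (2*π)) ∧
  ∃ a b : ℕ → ℝ → ℝ, ∀ x y,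
    T x y = ∑ k ∈ Finset.range (m+1),
      (a k y * Real.cos ((k : ℝ) * x) + b k y * Real.sin ((k : ℝ) * x))

/-- `T` is (an `L_p(T²)` function which is) a trigonometric polynomial of degree
at most `m` in the second variable. -/
def TrigPolyY (p : ℝ) (m : ℕ) (T : ℝ → ℝ → ℝ) : Prop :=
  Measurable (Function.uncurry T) ∧ Lp2Norm p T ≠ ⊤ ∧
  (∀ y, Function.Periodic (fun x => T x y) (2*π)) ∧
  ∃ a b : ℕ → ℝ → ℝ, ∀ x y,
    T x y = ∑ k ∈ Finset.range (m+1),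
      (a k x * Real.cos ((k : ℝ) * y) + b k x * Real.sin ((k : ℝ) * y))

/-- The best angular approximation `Y_{m₁,m₂}(f)_p`. -/
def Yapprox (p : ℝ) (m₁ m₂ : ℕ) (f : ℝ → ℝ → ℝ) : ℝ≥0∞ :=
  ⨅ (T₁ : ℝ → ℝ → ℝ) (_ : TrigPolyX p m₁ T₁) (T₂ : ℝ → ℝ → ℝ) (_ : TrigPolyY p m₂ T₂),
    Lp2Norm p (fun x y => f x y - T₁ x y - T₂ x y)

/-- The weighted sum of angular approximations
`n₁^{-α₁} n₂^{-α₂} {Σ_{ν₁=1}^{n₁+1} Σ_{ν₂=1}^{n₂+1} ν₁^{α₁s-1} ν₂^{α₂s-1} Y_{ν₁-1,ν₂-1}(f)_p^s}^{1/s}`. -/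
def Ysum (p α₁ α₂ s : ℝ) (n₁ n₂ : ℕ) (f : ℝ → ℝ → ℝ) : ℝ≥0∞ :=
  ENNReal.ofReal ((n₁:ℝ) ^ (-α₁) * (n₂:ℝ) ^ (-α₂)) *
    (∑ ν₁ ∈ Finset.Icc 1 (n₁+1), ∑ ν₂ ∈ Finset.Icc 1 (n₂+1),
      ENNReal.ofReal ((ν₁:ℝ) ^ (α₁*s-1) * (ν₂:ℝ) ^ (α₂*s-1)) *
        Yapprox p (ν₁-1) (ν₂-1) f ^ s) ^ (1/s)

/-- Cosine-cosine Fourier coefficient `a_{n₁,n₂}` of `f`. -/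
def fourierCC (f : ℝ → ℝ → ℝ) (n₁ n₂ : ℕ) : ℝ :=
  (1/π^2) * ∫ x in (0:ℝ)..(2*π), ∫ y in (0:ℝ)..(2*π),
    f x y * Real.cos ((n₁ : ℝ) * x) * Real.cos ((n₂ : ℝ) * y)

/-- Sine-cosine Fourier coefficient `b_{n₁,n₂}` of `f`. -/
def fourierSC (f : ℝ → ℝ → ℝ) (n₁ n₂ : ℕ) : ℝ :=
  (1/π^2) * ∫ x in (0:ℝ)..(2*π), ∫ y in (0:ℝ)..(2*π),
    f x y * Real.sin ((n₁ : ℝ) * x) * Real.cos ((n₂ : ℝ) * y)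

/-- Cosine-sine Fourier coefficient `c_{n₁,n₂}` of `f`. -/
def fourierCS (f : ℝ → ℝ → ℝ) (n₁ n₂ : ℕ) : ℝ :=
  (1/π^2) * ∫ x in (0:ℝ)..(2*π), ∫ y in (0:ℝ)..(2*π),
    f x y * Real.cos ((n₁ : ℝ) * x) * Real.sin ((n₂ : ℝ) * y)

/-- Sine-sine Fourier coefficient `d_{n₁,n₂}` of `f`. -/
def fourierSS (f : ℝ → ℝ → ℝ) (n₁ n₂ : ℕ) : ℝ :=
  (1/π^2) * ∫ x in (0:ℝ)..(2*π), ∫ y in (0:ℝ)..(2*π),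
    f x y * Real.sin ((n₁ : ℝ) * x) * Real.sin ((n₂ : ℝ) * y)

/-- The class `Λ_p`: `f ∈ L_p^0(T²)` with lacunary Fourier series
`Σ λ_{μ₁,μ₂} cos 2^{μ₁}x cos 2^{μ₂}y`. -/
def InLambdaClass (p : ℝ) (f : ℝ → ℝ → ℝ) (lam : ℕ → ℕ → ℝ) : Prop :=
  MemLp0 p f ∧
  (∀ μ₁ μ₂ : ℕ, fourierCC f (2^μ₁) (2^μ₂) = lam μ₁ μ₂) ∧
  (∀ n₁ n₂ : ℕ, (¬ ∃ μ₁ μ₂ : ℕ, n₁ = 2^μ₁ ∧ n₂ = 2^μ₂) → fourierCC f n₁ n₂ = 0) ∧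
  (∀ n₁ n₂ : ℕ, fourierSC f n₁ n₂ = 0 ∧ fourierCS f n₁ n₂ = 0 ∧ fourierSS f n₁ n₂ = 0)

theorem integral_comp_add_of_periodic {g : ℝ → ℝ} (hg : Function.Periodic g (2*π)) (t : ℝ) :
    ∫ x in (0:ℝ)..(2*π), g (x + t) = ∫ x in (0:ℝ)..(2*π), g x := by
  rw [intervalIntegral.integral_comp_add_right]
  have := hg.intervalIntegral_add_eq (0 + t) 0
  rw [zero_add] at this ⊢
  rw [add_comm (2*π) t, this, zero_add]

/-- A function with period `π` is orthogonal to `cos (x + φ)` over `[0, 2π]`. -/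
theorem integral_periodic_pi_mul_affine_cos {R : ℝ → ℝ} (hR : Continuous R)
    (hper : Function.Periodic R (2*π)) (A B φ : ℝ) :
    ∫ x in (0:ℝ)..(2*π), R (2*x) * (A + B * cos (x + φ)) =
      A * ∫ x in (0:ℝ)..(2*π), R x := by
  have h1 : ∫ x in (0:ℝ)..(2*π), R (2*x) = ∫ x in (0:ℝ)..(2*π), R x := by
    rw [intervalIntegral.integral_comp_mul_left (fun x => R x) (two_ne_zero), mul_zero]
    have h2 : ∫ x in (0:ℝ)..(2*(2*π)), R x = 2 * ∫ x in (0:ℝ)..(2*π), R x := by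
      rw [← intervalIntegral.integral_add_adjacent_intervals (b := 2*π)
        (hR.intervalIntegrable _ _) (hR.intervalIntegrable _ _)]
      have := hper.intervalIntegral_add_eq (2*π) 0
      rw [zero_add] at this
      rw [show 2*(2*π) = 2*π + 2*π by ring, this]; ring
    rw [h2, smul_eq_mul]; ring
  have h3 : ∫ x in (0:ℝ)..(2*π), R (2*x) * cos (x + φ) = 0 := by
    have hp : Function.Periodic (fun x => R (2*x) * cos (x + φ)) (2*π) := by
      intro x
      have e1 : R (2*(x+2*π)) = R (2*x) := by
        rw [show 2*(x+2*π) = (2*x + 2*π) + 2*π by ring, hper, hper]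
      have e2 : cos (x + 2*π + φ) = cos (x + φ) := by
        rw [show x + 2*π + φ = (x + φ) + 2*π by ring, cos_add_two_pi]
      simp only [e1, e2]
    have h4 := integral_comp_add_of_periodic hp π
    have h5 : ∀ x, R (2*(x+π)) * cos (x + π + φ) = - (R (2*x) * cos (x+φ)) := by
      intro x
      rw [show 2*(x+π) = 2*x + 2*π by ring, hper, show x + π + φ = (x + φ) + π by ring,
        cos_add_pi]; ring
    simp only [h5, intervalIntegral.integral_neg] at h4
    linarith
  have : ∀ x, R (2*x) * (A + B * cos (x + φ)) =
      A * R (2*x) + B * (R (2*x) * cos (x+φ)) := fun x => by ring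
  simp only [this]
  rw [intervalIntegral.integral_add, intervalIntegral.integral_const_mul,
    intervalIntegral.integral_const_mul, h1, h3]
  · ring
  · exact Continuous.intervalIntegrable (by fun_prop) _ _
  · exact Continuous.intervalIntegrable (by fun_prop) _ _

theorem integral_riesz_product (N : ℕ) (A B φ : ℕ → ℝ) :
    ∫ x in (0:ℝ)..(2*π), ∏ j ∈ Finset.range N, (A j + B j * cos (2^j * x + φ j)) =
      2*π * ∏ j ∈ Finset.range N, A j := by
  induction N generalizing A B φ with
  | zero => simp
  | succ N ih =>
    have h : ∀ x : ℝ, ∏ j ∈ Finset.range (N+1), (A j + B j * cos (2^j * x + φ j)) =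
        (fun z => ∏ j ∈ Finset.range N, (A (j+1) + B (j+1) * cos (2^j * z + φ (j+1)))) (2*x) *
          (A 0 + B 0 * cos (x + φ 0)) := by
      intro x
      rw [Finset.prod_range_succ']
      simp only [pow_zero, one_mul, pow_succ, mul_assoc]
    simp only [h]
    rw [integral_periodic_pi_mul_affine_cos (R := fun z =>
      ∏ j ∈ Finset.range N, (A (j+1) + B (j+1) * cos (2^j * z + φ (j+1)))),
      ih (fun j => A (j+1)) (fun j => B (j+1)) (fun j => φ (j+1)), Finset.prod_range_succ']
    · ring
    · fun_prop
    · intro x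
      refine Finset.prod_congr rfl fun j _ => ?_
      rw [show (2:ℝ)^j * (x + 2*π) + φ (j+1) = (2^j * x + φ (j+1)) + ((2^j : ℕ):ℝ) * (2*π) by
        push_cast; ring, cos_add_nat_mul_two_pi]

/-- Lacunary cosine polynomials are sub-Gaussian. -/
theorem integral_exp_lacunary_le (N : ℕ) (a φ : ℕ → ℝ) :
    ∫ x in (0:ℝ)..(2*π), exp (∑ j ∈ Finset.range N, a j * cos (2^j * x + φ j)) ≤
      2*π * exp ((∑ j ∈ Finset.range N, a j ^ 2) / 2) := by
  calc _ ≤ ∫ x in (0:ℝ)..(2*π), ∏ j ∈ Finset.range N,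
        (cosh (a j) + sinh (a j) * cos (2^j * x + φ j)) := by
        refine intervalIntegral.integral_mono_on (by positivity)
          (Continuous.intervalIntegrable (by fun_prop) _ _)
          (Continuous.intervalIntegrable (by fun_prop) _ _) fun x _ => ?_
        rw [exp_sum]
        refine Finset.prod_le_prod (fun j _ => (exp_pos _).le) fun j _ => ?_
        have := exp_mul_le_cosh_add_mul_sinh (abs_cos_le_one (2^j * x + φ j)) (a j)
        rw [mul_comm (a j)]; linarith
    _ = 2*π * ∏ j ∈ Finset.range N, cosh (a j) := integral_riesz_product N _ _ φ
    _ ≤ _ := by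
        rw [Finset.sum_div, exp_sum]
        gcongr with j _
        exact cosh_le_exp_half_sq _

/-- The constant in the one-dimensional lacunary moment inequality. -/
def lacConst (m : ℕ) : ℝ := (Nat.factorial (2*m) : ℝ) * (4 * π * exp (1/2))

theorem lacConst_pos (m : ℕ) : 0 < lacConst m := by unfold lacConst; positivity

theorem integral_pow_lacunary_le (m N : ℕ) (hm : m ≠ 0) (a φ : ℕ → ℝ) :
    ∫ x in (0:ℝ)..(2*π), (∑ j ∈ Finset.range N, a j * cos (2^j * x + φ j)) ^ (2*m) ≤
      lacConst m * (∑ j ∈ Finset.range N, a j ^ 2) ^ m := by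
  set s := ∑ j ∈ Finset.range N, a j ^ 2 with hs
  have hs0 : 0 ≤ s := Finset.sum_nonneg fun _ _ => sq_nonneg _
  rcases hs0.eq_or_lt with h0 | hpos
  · have ha : ∀ j ∈ Finset.range N, a j = 0 := by
      intro j hj
      have := (Finset.sum_eq_zero_iff_of_nonneg (fun _ _ => sq_nonneg _)).1 h0.symm j hj
      simpa using this
    have : ∀ x : ℝ, ∑ j ∈ Finset.range N, a j * cos (2^j * x + φ j) = 0 := fun x =>
      Finset.sum_eq_zero fun j hj => by rw [ha j hj, zero_mul]
    simp only [this, ← h0]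
    simp [hm]
  · set r := √s
    have hr : 0 < r := Real.sqrt_pos.2 hpos
    have hr2 : r ^ 2 = s := Real.sq_sqrt hs0
    set b : ℕ → ℝ := fun j => a j / r
    have hb : ∑ j ∈ Finset.range N, b j ^ 2 = 1 := by
      simp only [b, div_pow, ← Finset.sum_div, hr2]
      exact div_self hpos.ne'
    have hb' : ∑ j ∈ Finset.range N, (-b j) ^ 2 = 1 := by simpa using hb
    have hab : ∀ x : ℝ, (∑ j ∈ Finset.range N, a j * cos (2^j * x + φ j)) ^ (2*m) =
        s ^ m * (∑ j ∈ Finset.range N, b j * cos (2^j * x + φ j)) ^ (2*m) := by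
      intro x
      rw [← hr2, ← pow_mul, ← mul_pow, Finset.mul_sum]
      congr 1
      refine Finset.sum_congr rfl fun j _ => ?_
      simp only [b]; field_simp
    simp only [hab, intervalIntegral.integral_const_mul]
    rw [mul_comm]
    refine mul_le_mul_of_nonneg_right ?_ (by positivity)
    calc _ ≤ ∫ x in (0:ℝ)..(2*π), (Nat.factorial (2*m) : ℝ) *
          (exp (∑ j ∈ Finset.range N, b j * cos (2^j * x + φ j)) +
           exp (∑ j ∈ Finset.range N, (-b j) * cos (2^j * x + φ j))) := by
          refine intervalIntegral.integral_mono_on (by positivity)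
            (Continuous.intervalIntegrable (by fun_prop) _ _)
            (Continuous.intervalIntegrable (by fun_prop) _ _) fun x _ => ?_
          simp only [neg_mul, Finset.sum_neg_distrib]
          set S := ∑ j ∈ Finset.range N, b j * cos (2^j * x + φ j)
          have h1 := pow_div_factorial_le_exp |S| (abs_nonneg S) (2*m)
          rw [div_le_iff₀ (by positivity), (even_two_mul m).pow_abs, mul_comm (exp _)] at h1
          refine h1.trans (mul_le_mul_of_nonneg_left ?_ (by positivity))
          rcases abs_cases S with ⟨h, _⟩ | ⟨h, _⟩ <;> rw [h] <;>
            linarith [exp_pos S, exp_pos (-S)]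
      _ ≤ (Nat.factorial (2*m) : ℝ) * (2*π * exp (1/2) + 2*π*exp (1/2)) := by
          rw [intervalIntegral.integral_const_mul, intervalIntegral.integral_add
            (Continuous.intervalIntegrable (by fun_prop) _ _)
            (Continuous.intervalIntegrable (by fun_prop) _ _)]
          have h1 := integral_exp_lacunary_le N b φ
          have h2 := integral_exp_lacunary_le N (fun j => -b j) φ
          rw [hb] at h1
          rw [hb'] at h2
          gcongr
      _ = _ := by unfold lacConst; ring

/-- The finite double lacunary cosine polynomial with phases. -/
def lacPoly (N : ℕ) (b : ℕ → ℕ → ℝ) (φ ψ : ℕ → ℝ) (x y : ℝ) : ℝ :=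
  ∑ i ∈ Finset.range N, ∑ j ∈ Finset.range N,
    b i j * cos (2^i * x + φ i) * cos (2^j * y + ψ j)

theorem lacPoly_continuous (N : ℕ) (b : ℕ → ℕ → ℝ) (φ ψ : ℕ → ℝ) :
    Continuous (Function.uncurry (lacPoly N b φ ψ)) := by
  unfold lacPoly Function.uncurry; fun_prop

theorem sum_sq_eq_zero_of {N : ℕ} {c : ℕ → ℝ} (h : ∑ j ∈ Finset.range N, c j ^ 2 = 0)
    {j : ℕ} (hj : j ∈ Finset.range N) : c j = 0 := by
  have := (Finset.sum_eq_zero_iff_of_nonneg (fun _ _ => sq_nonneg _)).1 h j hj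
  simpa using this

theorem integral_integral_pow_lacPoly_le (m N : ℕ) (hm : m ≠ 0) (b : ℕ → ℕ → ℝ) (φ ψ : ℕ → ℝ) :
    ∫ y in (0:ℝ)..(2*π), ∫ x in (0:ℝ)..(2*π), lacPoly N b φ ψ x y ^ (2*m) ≤
      lacConst m ^ 2 *
        (∑ i ∈ Finset.range N, ∑ j ∈ Finset.range N, b i j ^ 2) ^ m := by
  have hK := lacConst_pos m
  set w : ℕ → ℝ := fun i => ∑ j ∈ Finset.range N, b i j ^ 2 with hw
  have hw0 : ∀ i, 0 ≤ w i := fun i => Finset.sum_nonneg fun _ _ => sq_nonneg _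
  set B : ℕ → ℝ → ℝ := fun i y => ∑ j ∈ Finset.range N, b i j * cos (2^j * y + ψ j) with hB
  have hBc : ∀ i, Continuous (B i) := fun i => by simp only [hB]; fun_prop
  have hP : ∀ x y, lacPoly N b φ ψ x y =
      ∑ i ∈ Finset.range N, B i y * cos (2^i * x + φ i) := by
    intro x y
    unfold lacPoly
    refine Finset.sum_congr rfl fun i _ => ?_
    simp only [hB, Finset.sum_mul]
    exact Finset.sum_congr rfl fun j _ => by ring
  set s := ∑ i ∈ Finset.range N, w i with hs
  have hs0 : 0 ≤ s := Finset.sum_nonneg fun _ _ => hw0 _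
  have hB0 : ∀ i, w i = 0 → ∀ y, B i y = 0 := by
    intro i hi y
    refine Finset.sum_eq_zero fun j hj => ?_
    rw [sum_sq_eq_zero_of hi hj, zero_mul]
  have step1 : ∀ y, ∫ x in (0:ℝ)..(2*π), lacPoly N b φ ψ x y ^ (2*m) ≤
      lacConst m * (∑ i ∈ Finset.range N, B i y ^ 2) ^ m := by
    intro y
    simp only [hP]
    exact integral_pow_lacunary_le m N hm (fun i => B i y) φ
  rcases hs0.eq_or_lt with h0 | hpos
  · have hwz : ∀ i ∈ Finset.range N, w i = 0 := fun i hi =>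
      (Finset.sum_eq_zero_iff_of_nonneg (fun _ _ => hw0 _)).1 h0.symm i hi
    have hPz : ∀ x y, lacPoly N b φ ψ x y = 0 := fun x y => by
      rw [hP]
      exact Finset.sum_eq_zero fun i hi => by rw [hB0 i (hwz i hi), zero_mul]
    simp only [hPz, ← h0]
    simp [hm]
  have step2 : ∀ y, (∑ i ∈ Finset.range N, B i y ^ 2) ^ m ≤
      s ^ m * ∑ i ∈ Finset.range N, (w i / s) * (B i y ^ 2 / w i) ^ m := by
    intro y
    have h1 : ∑ i ∈ Finset.range N, w i / s = 1 := by
      rw [← Finset.sum_div]; exact div_self hpos.ne'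
    have h3 := Real.pow_arith_mean_le_arith_mean_pow (Finset.range N) (fun i => w i / s)
      (fun i => B i y ^ 2 / w i) (fun i _ => div_nonneg (hw0 i) hs0) h1
      (fun i _ => div_nonneg (sq_nonneg _) (hw0 i)) m
    have h4 : ∑ i ∈ Finset.range N, B i y ^ 2 =
        s * ∑ i ∈ Finset.range N, w i / s * (B i y ^ 2 / w i) := by
      rw [Finset.mul_sum]
      refine Finset.sum_congr rfl fun i _ => ?_
      rcases eq_or_ne (w i) 0 with h | h
      · rw [hB0 i h, h]; simp
      · field_simp
    rw [h4, mul_pow]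
    gcongr
  have step3 : ∀ i, ∫ y in (0:ℝ)..(2*π), (B i y ^ 2 / w i) ^ m ≤ lacConst m := by
    intro i
    rcases eq_or_ne (w i) 0 with h | h
    · simp [h, hm, hK.le]
    · have h1 := integral_pow_lacunary_le m N hm (b i) ψ
      have hwpos : 0 < w i := lt_of_le_of_ne (hw0 i) h.symm
      simp only [div_pow, ← pow_mul]
      rw [intervalIntegral.integral_div, div_le_iff₀ (by positivity)]
      exact h1
  calc _ ≤ ∫ y in (0:ℝ)..(2*π), lacConst m *
        (s ^ m * ∑ i ∈ Finset.range N, (w i / s) * (B i y ^ 2 / w i) ^ m) := by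
        refine intervalIntegral.integral_mono_on (by positivity) ?_
          (Continuous.intervalIntegrable (by fun_prop) _ _) fun y _ => ?_
        · have hc := (lacPoly_continuous N b φ ψ)
          have hc2 : Continuous (Function.uncurry fun y x => lacPoly N b φ ψ x y ^ (2*m)) :=
            (hc.comp continuous_swap).pow _
          exact (intervalIntegral.continuous_parametric_intervalIntegral_of_continuous'
            hc2 _ _).intervalIntegrable _ _
        · exact (step1 y).trans (mul_le_mul_of_nonneg_left (step2 y) hK.le)
    _ = lacConst m * s ^ m * ∑ i ∈ Finset.range N, (w i / s) *
          ∫ y in (0:ℝ)..(2*π), (B i y ^ 2 / w i) ^ m := by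
        rw [intervalIntegral.integral_const_mul, intervalIntegral.integral_const_mul,
          intervalIntegral.integral_finsetSum]
        · simp only [intervalIntegral.integral_const_mul]; ring
        · exact fun i _ => Continuous.intervalIntegrable (by fun_prop) _ _
    _ ≤ lacConst m * s ^ m * ∑ i ∈ Finset.range N, (w i / s) * lacConst m := by
        gcongr with i _
        exact step3 i
    _ = _ := by
        rw [← Finset.sum_mul, ← Finset.sum_div, div_self hpos.ne']; ring

/-- Lebesgue measure on the period square `(0, 2π]²`. -/
def sqM : Measure (ℝ × ℝ) :=
  (volume.restrict (Set.Ioc 0 (2*π))).prod (volume.restrict (Set.Ioc 0 (2*π)))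

instance : IsFiniteMeasure sqM := by unfold sqM; infer_instance

theorem Lp2Norm_eq_eLpNorm {p : ℝ} (hp : 0 < p) {f : ℝ → ℝ → ℝ}
    (hf : Measurable (Function.uncurry f)) :
    Lp2Norm p f = eLpNorm (Function.uncurry f) (ENNReal.ofReal p) sqM := by
  have h : ∀ z : ℝ × ℝ, ENNReal.ofReal (|f z.1 z.2| ^ p) =
      ‖Function.uncurry f z‖ₑ ^ p := by
    intro z
    rw [← ENNReal.ofReal_rpow_of_nonneg (abs_nonneg _) hp.le, Real.enorm_eq_ofReal_abs]
    rfl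
  rw [eLpNorm_eq_lintegral_rpow_enorm_toReal (by simpa using hp) ENNReal.ofReal_ne_top,
    ENNReal.toReal_ofReal hp.le, sqM, lintegral_prod _ (by fun_prop), Lp2Norm]
  simp only [← h]

theorem integral_sqM {g : ℝ × ℝ → ℝ} (hg : Integrable g sqM) :
    ∫ z, g z ∂sqM = ∫ x in (0:ℝ)..(2*π), ∫ y in (0:ℝ)..(2*π), g (x, y) := by
  have h2 : (0:ℝ) ≤ 2*π := by positivity
  simp only [intervalIntegral.integral_of_le h2]
  exact integral_prod _ hg

theorem integral_sqM_symm {g : ℝ × ℝ → ℝ} (hg : Integrable g sqM) :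
    ∫ z, g z ∂sqM = ∫ y in (0:ℝ)..(2*π), ∫ x in (0:ℝ)..(2*π), g (x, y) := by
  have h2 : (0:ℝ) ≤ 2*π := by positivity
  simp only [intervalIntegral.integral_of_le h2]
  exact integral_prod_symm _ hg

theorem memLp_of_continuous_of_bound {g : ℝ × ℝ → ℝ} (hg : Continuous g) {C : ℝ}
    (hC : ∀ z, |g z| ≤ C) (q : ℝ≥0∞) : MemLp g q sqM :=
  MemLp.of_bound hg.aestronglyMeasurable C (ae_of_all _ hC)

theorem exists_abs_lacPoly_le (N : ℕ) (b : ℕ → ℕ → ℝ) (φ ψ : ℕ → ℝ) :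
    ∃ K : ℝ, ∀ z, |Function.uncurry (lacPoly N b φ ψ) z| ≤ K := by
  refine ⟨∑ i ∈ Finset.range N, ∑ j ∈ Finset.range N, |b i j|, fun z => ?_⟩
  simp only [Function.uncurry, lacPoly]
  refine (Finset.abs_sum_le_sum_abs _ _).trans (Finset.sum_le_sum fun i _ => ?_)
  refine (Finset.abs_sum_le_sum_abs _ _).trans (Finset.sum_le_sum fun j _ => ?_)
  rw [abs_mul, abs_mul, mul_assoc]
  exact mul_le_of_le_one_right (abs_nonneg _)
    (mul_le_one₀ (abs_cos_le_one _) (abs_nonneg _) (abs_cos_le_one _))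

theorem memLp_lacPoly (N : ℕ) (b : ℕ → ℕ → ℝ) (φ ψ : ℕ → ℝ) (q : ℝ≥0∞) :
    MemLp (Function.uncurry (lacPoly N b φ ψ)) q sqM := by
  obtain ⟨K, hK⟩ := exists_abs_lacPoly_le N b φ ψ
  exact memLp_of_continuous_of_bound (lacPoly_continuous N b φ ψ) hK q

theorem eLpNorm_lacPoly_le {q : ℝ} (hq : 0 < q) : ∃ C : ℝ, 0 < C ∧
    ∀ (N : ℕ) (b : ℕ → ℕ → ℝ) (φ ψ : ℕ → ℝ),
      eLpNorm (Function.uncurry (lacPoly N b φ ψ)) (ENNReal.ofReal q) sqM ≤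
        ENNReal.ofReal (C * √(∑ i ∈ Finset.range N, ∑ j ∈ Finset.range N, b i j ^ 2)) := by
  set m := ⌈q⌉₊
  have hm : m ≠ 0 := (Nat.ceil_pos.2 hq).ne'
  have hmq : q ≤ m := Nat.le_ceil q
  have hm0 : (0:ℝ) < m := hq.trans_le hmq
  set V := sqM Set.univ ^ (1 / (ENNReal.ofReal q).toReal - 1 / (ENNReal.ofReal (2*m)).toReal)
  have hV : V ≠ ⊤ := by
    refine ENNReal.rpow_ne_top_of_nonneg ?_ (measure_ne_top _ _)
    rw [ENNReal.toReal_ofReal hq.le, ENNReal.toReal_ofReal (by positivity), sub_nonneg]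
    exact one_div_le_one_div_of_le hq (by linarith)
  set K := (lacConst m ^ 2) ^ ((2*m:ℝ)⁻¹)
  have hK : 0 < K := by have := lacConst_pos m; positivity
  refine ⟨K * (V.toReal + 1), by positivity, fun N b φ ψ => ?_⟩
  set s := ∑ i ∈ Finset.range N, ∑ j ∈ Finset.range N, b i j ^ 2
  have hs : 0 ≤ s := Finset.sum_nonneg fun _ _ => Finset.sum_nonneg fun _ _ => sq_nonneg _
  set Q := Function.uncurry (lacPoly N b φ ψ)
  have hQm : ∀ q, MemLp Q q sqM := memLp_lacPoly N b φ ψ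
  have h1 : eLpNorm Q (ENNReal.ofReal (2*m)) sqM ≤ ENNReal.ofReal (K * √s) := by
    rw [(hQm _).eLpNorm_eq_integral_rpow_norm (by simpa using hm)
      ENNReal.ofReal_ne_top, ENNReal.toReal_ofReal (by positivity)]
    apply ENNReal.ofReal_le_ofReal
    have h2 : ∀ z, ‖Q z‖ ^ (2*m:ℝ) = Q z ^ (2*m) := by
      intro z
      rw [show (2*m:ℝ) = ((2*m : ℕ) : ℝ) by push_cast; ring, rpow_natCast, Real.norm_eq_abs,
        (even_two_mul m).pow_abs]
    have hint : Integrable (fun z => Q z ^ (2*m)) sqM := by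
      have := (hQm (ENNReal.ofReal (2*m))).integrable_norm_rpow
        (by simpa using hm) ENNReal.ofReal_ne_top
      rw [ENNReal.toReal_ofReal (by positivity)] at this
      simpa only [h2] using this
    simp only [h2]
    rw [integral_sqM_symm hint]
    have h3 := integral_integral_pow_lacPoly_le m N hm b φ ψ
    have h4 : √s = (s ^ m) ^ ((2*m:ℝ)⁻¹) := by
      rw [← rpow_natCast, ← rpow_mul hs, sqrt_eq_rpow]
      congr 1
      field_simp
    rw [h4, ← mul_rpow (by positivity) (by positivity)]
    refine rpow_le_rpow ?_ h3 (by positivity)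
    refine intervalIntegral.integral_nonneg (by positivity) fun y _ =>
      intervalIntegral.integral_nonneg (by positivity) fun x _ => (even_two_mul m).pow_nonneg _
  calc _ ≤ eLpNorm Q (ENNReal.ofReal (2*m)) sqM * V :=
        eLpNorm_le_eLpNorm_mul_rpow_measure_univ
          (ENNReal.ofReal_le_ofReal (by linarith)) (hQm 1).1
    _ ≤ ENNReal.ofReal (K * √s) * ENNReal.ofReal (V.toReal + 1) := by
        gcongr
        rw [← ENNReal.ofReal_toReal hV, ENNReal.toReal_ofReal ENNReal.toReal_nonneg]
        exact ENNReal.ofReal_le_ofReal (by linarith)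
    _ = _ := by rw [← ENNReal.ofReal_mul (by positivity)]; congr 1; ring

/-- Lower bound by duality with a lacunary polynomial. -/
theorem sqrt_sum_sq_le_eLpNorm {p : ℝ} (hp : 1 < p) : ∃ C : ℝ, 0 < C ∧
    ∀ (N : ℕ) (b : ℕ → ℕ → ℝ) (φ ψ : ℕ → ℝ) (g : ℝ × ℝ → ℝ), AEStronglyMeasurable g sqM →
      π ^ 2 * ∑ i ∈ Finset.range N, ∑ j ∈ Finset.range N, b i j ^ 2 ≤
        ∫ z, g z * Function.uncurry (lacPoly N b φ ψ) z ∂sqM →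
      ENNReal.ofReal (√(∑ i ∈ Finset.range N, ∑ j ∈ Finset.range N, b i j ^ 2)) ≤
        ENNReal.ofReal C * eLpNorm g (ENNReal.ofReal p) sqM := by
  have hpq := Real.HolderConjugate.conjExponent hp
  obtain ⟨C, hC, hQ⟩ := eLpNorm_lacPoly_le hpq.symm.pos
  refine ⟨C, hC, fun N b φ ψ g hg hpair => ?_⟩
  have := hpq.ennrealOfReal
  set s := ∑ i ∈ Finset.range N, ∑ j ∈ Finset.range N, b i j ^ 2
  have hs : 0 ≤ s := Finset.sum_nonneg fun _ _ => Finset.sum_nonneg fun _ _ => sq_nonneg _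
  set Q := Function.uncurry (lacPoly N b φ ψ)
  rcases hs.eq_or_lt with h0 | hpos
  · rw [← h0]; simp
  have hsq : 0 < √s := Real.sqrt_pos.2 hpos
  have h1 : ENNReal.ofReal (√s) * ENNReal.ofReal (√s) ≤
      ENNReal.ofReal (√s) * (ENNReal.ofReal C * eLpNorm g (ENNReal.ofReal p) sqM) := by
    calc _ = ENNReal.ofReal s := by rw [← ENNReal.ofReal_mul hsq.le, Real.mul_self_sqrt hs]
      _ ≤ ENNReal.ofReal (∫ z, g z * Q z ∂sqM) := by
          refine ENNReal.ofReal_le_ofReal (le_trans ?_ hpair)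
          have : (1:ℝ) ≤ π ^ 2 := by nlinarith [pi_gt_three]
          nlinarith
      _ ≤ ‖∫ z, g z * Q z ∂sqM‖ₑ := by
          rw [Real.enorm_eq_ofReal_abs]
          exact ENNReal.ofReal_le_ofReal (le_abs_self _)
      _ ≤ ∫⁻ z, ‖g z * Q z‖ₑ ∂sqM := enorm_integral_le_lintegral_enorm _
      _ = eLpNorm (g • Q) 1 sqM := by rw [eLpNorm_one_eq_lintegral_enorm]; rfl
      _ ≤ eLpNorm g (ENNReal.ofReal p) sqM * eLpNorm Q (ENNReal.ofReal p.conjExponent) sqM :=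
          eLpNorm_smul_le_mul_eLpNorm (memLp_lacPoly N b φ ψ 1).1 hg
      _ ≤ eLpNorm g (ENNReal.ofReal p) sqM * ENNReal.ofReal (C * √s) := by
          gcongr; exact hQ N b φ ψ
      _ = _ := by rw [ENNReal.ofReal_mul hC.le]; ring
  exact (ENNReal.mul_le_mul_iff_right (by simpa using hsq) ENNReal.ofReal_ne_top).1 h1

theorem integral_cos_lacunary_mul (i j : ℕ) (s t : ℝ) (hij : i = j → s = t) :
    ∫ x in (0:ℝ)..(2*π), cos (2^i * x + s) * cos (2^j * x + t) = if i = j then π else 0 := by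
  have key : ∀ (k : ℤ) (u : ℝ), k ≠ 0 → ∫ x in (0:ℝ)..(2*π), cos (k * x + u) = 0 := by
    intro k u hk
    have hk' : (k:ℝ) ≠ 0 := by exact_mod_cast hk
    rw [intervalIntegral.integral_comp_mul_add (fun x => cos x) hk', integral_cos]
    rw [show (k:ℝ) * (2*π) + u = u + k * (2*π) by ring, sin_add_int_mul_two_pi]
    simp
  have hprod : ∀ x : ℝ, cos (2^i * x + s) * cos (2^j * x + t) =
      (1/2) * cos (((2^i + 2^j : ℤ) : ℝ) * x + (s + t)) +
      (1/2) * cos (((2^i - 2^j : ℤ) : ℝ) * x + (s - t)) := by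
    intro x
    push_cast
    rw [show ((2:ℝ)^i + 2^j) * x + (s+t) = (2^i * x + s) + (2^j*x + t) by ring,
      show ((2:ℝ)^i - 2^j) * x + (s-t) = (2^i * x + s) - (2^j*x + t) by ring,
      cos_add (2^i * x + s) (2^j * x + t), cos_sub (2^i * x + s) (2^j * x + t)]
    ring
  simp only [hprod]
  rw [intervalIntegral.integral_add (Continuous.intervalIntegrable (by fun_prop) _ _)
    (Continuous.intervalIntegrable (by fun_prop) _ _), intervalIntegral.integral_const_mul,
    intervalIntegral.integral_const_mul, key _ _ (by positivity)]
  split_ifs with h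
  · subst h
    simp [hij rfl]
  · rw [key]
    · simp
    · rw [sub_ne_zero]
      exact fun h' => h (Nat.pow_right_injective le_rfl (by exact_mod_cast h'))

theorem integral_lacPoly_mul_lacPoly (N : ℕ) (a b : ℕ → ℕ → ℝ) (φ ψ : ℕ → ℝ) :
    ∫ z, Function.uncurry (lacPoly N a φ ψ) z * Function.uncurry (lacPoly N b φ ψ) z ∂sqM =
      π ^ 2 * ∑ i ∈ Finset.range N, ∑ j ∈ Finset.range N, a i j * b i j := by
  have hint : ∀ i j k l, Integrable (fun z : ℝ × ℝ =>
      (a i j * b k l) * ((cos (2^i * z.1 + φ i) * cos (2^k * z.1 + φ k)) *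
        (cos (2^j * z.2 + ψ j) * cos (2^l * z.2 + ψ l)))) sqM := by
    intro i j k l
    refine Integrable.const_mul ?_ _
    rw [← memLp_one_iff_integrable]
    refine memLp_of_continuous_of_bound (by fun_prop) (C := 1) (fun z => ?_) _
    simp only [abs_mul]
    have := fun t => abs_cos_le_one t
    exact mul_le_one₀ (mul_le_one₀ (this _) (abs_nonneg _) (this _)) (by positivity)
      (mul_le_one₀ (this _) (abs_nonneg _) (this _))
  have hexp : ∀ z : ℝ × ℝ,
      Function.uncurry (lacPoly N a φ ψ) z * Function.uncurry (lacPoly N b φ ψ) z =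
      ∑ i ∈ Finset.range N, ∑ j ∈ Finset.range N, ∑ k ∈ Finset.range N, ∑ l ∈ Finset.range N,
      (a i j * b k l) * ((cos (2^i * z.1 + φ i) * cos (2^k * z.1 + φ k)) *
        (cos (2^j * z.2 + ψ j) * cos (2^l * z.2 + ψ l))) := by
    intro z
    simp only [Function.uncurry, lacPoly]
    rw [Finset.sum_mul]
    refine Finset.sum_congr rfl fun i _ => ?_
    rw [Finset.sum_mul]
    refine Finset.sum_congr rfl fun j _ => ?_
    rw [Finset.mul_sum]
    refine Finset.sum_congr rfl fun k _ => ?_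
    rw [Finset.mul_sum]
    refine Finset.sum_congr rfl fun l _ => ?_
    ring
  simp only [hexp]
  rw [integral_finsetSum _ fun i _ => integrable_finsetSum _ fun j _ =>
    integrable_finsetSum _ fun k _ => integrable_finsetSum _ fun l _ => hint i j k l,
    Finset.mul_sum]
  refine Finset.sum_congr rfl fun i hi => ?_
  rw [integral_finsetSum _ fun j _ =>
    integrable_finsetSum _ fun k _ => integrable_finsetSum _ fun l _ => hint i j k l,
    Finset.mul_sum]
  refine Finset.sum_congr rfl fun j hj => ?_
  have hval : ∀ k l, ∫ z : ℝ × ℝ, (a i j * b k l) *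
      ((cos (2^i * z.1 + φ i) * cos (2^k * z.1 + φ k)) *
        (cos (2^j * z.2 + ψ j) * cos (2^l * z.2 + ψ l))) ∂sqM =
      if i = k then (if j = l then π ^ 2 * (a i j * b k l) else 0) else 0 := by
    intro k l
    rw [integral_sqM (hint i j k l)]
    simp only [intervalIntegral.integral_const_mul, intervalIntegral.integral_mul_const]
    rw [integral_cos_lacunary_mul i k _ _ (by rintro rfl; rfl),
      integral_cos_lacunary_mul j l _ _ (by rintro rfl; rfl)]
    split_ifs <;> ring
  rw [integral_finsetSum _ fun k _ => integrable_finsetSum _ fun l _ => hint i j k l]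
  have : ∀ k ∈ Finset.range N, ∫ z : ℝ × ℝ, ∑ l ∈ Finset.range N, (a i j * b k l) *
      ((cos (2^i * z.1 + φ i) * cos (2^k * z.1 + φ k)) *
        (cos (2^j * z.2 + ψ j) * cos (2^l * z.2 + ψ l))) ∂sqM =
      if i = k then π ^ 2 * (a i j * b k j) else 0 := by
    intro k _
    rw [integral_finsetSum _ fun l _ => hint i j k l]
    simp only [hval]
    split_ifs with h
    · rw [Finset.sum_ite_eq, if_pos hj]
    · simp
  rw [Finset.sum_congr rfl this, Finset.sum_ite_eq, if_pos hi]

theorem fracBinom_eq_choose (α : ℝ) (n : ℕ) : fracBinom α n = Ring.choose α n := by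
  induction n with
  | zero => simp [fracBinom]
  | succ n ih =>
    rw [fracBinom, ih, Ring.choose_eq_smul, Ring.choose_eq_smul, descPochhammer_succ_right]
    simp only [Polynomial.smeval_mul, Polynomial.smeval_sub, Polynomial.smeval_X,
      Polynomial.smeval_natCast, smul_eq_mul, Nat.factorial_succ]
    push_cast
    have h1 : (n.factorial : ℝ) ≠ 0 := by positivity
    have h2 : (n:ℝ) + 1 ≠ 0 := by positivity
    simp
    field_simp

/-- The coefficients of the fractional difference. -/
def diffCoeff (α : ℝ) (ν : ℕ) : ℝ := (-1 : ℝ) ^ ν * fracBinom α ν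

theorem abs_diffCoeff (α : ℝ) (ν : ℕ) : |diffCoeff α ν| = |fracBinom α ν| := by
  simp [diffCoeff, abs_mul]

theorem summable_abs_diffCoeff {α : ℝ} (hα : 0 < α) : Summable fun ν => |diffCoeff α ν| := by
  simp only [abs_diffCoeff]
  obtain ⟨N, hN⟩ := exists_nat_ge α
  rw [← summable_nat_add_iff N]
  set a : ℕ → ℝ := fun k => |fracBinom α (k + N)|
  have hrec : ∀ k, ((k + 1 + N : ℕ) : ℝ) * a (k+1) = ((k + N : ℕ) - α) * a k := by
    intro k
    simp only [a]
    rw [show k + 1 + N = (k + N) + 1 by ring, fracBinom, abs_div, abs_mul,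
      abs_of_nonpos (a := α - ((k+N : ℕ):ℝ)) (by push_cast; linarith [(k.cast_nonneg : (0:ℝ) ≤ k)]),
      abs_of_pos (a := ((k+N : ℕ):ℝ) + 1) (by positivity)]
    have : ((k + N : ℕ) : ℝ) + 1 ≠ 0 := by positivity
    push_cast at this ⊢
    field_simp
    ring
  refine summable_of_sum_range_le (c := (N * a 0) / α) (fun _ => abs_nonneg _) fun n => ?_
  rw [le_div_iff₀ hα, Finset.sum_mul]
  have : ∀ n, ∑ i ∈ Finset.range n, a i * α = N * a 0 - ((n + N : ℕ) : ℝ) * a n := by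
    intro n
    induction n with
    | zero => simp
    | succ n ih => rw [Finset.sum_range_succ, ih, hrec]; push_cast; ring
  rw [this]
  have : 0 ≤ ((n + N : ℕ) : ℝ) * a n := by positivity
  linarith

theorem norm_tsum_diffCoeff {α : ℝ} (hα : 0 < α) {z : ℂ} (hz : ‖z‖ ≤ 1) :
    ‖∑' ν, (diffCoeff α ν : ℂ) * z ^ ν‖ = ‖1 - z‖ ^ α := by
  have hS := summable_abs_diffCoeff hα
  have hcont : ContinuousOn (fun z : ℂ => ∑' ν, (diffCoeff α ν : ℂ) * z ^ ν)
      (Metric.closedBall 0 1) := by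
    refine continuousOn_tsum (fun ν => by fun_prop) hS fun ν z hz => ?_
    rw [norm_mul, norm_pow, Complex.norm_real, Real.norm_eq_abs]
    have : ‖z‖ ≤ 1 := by simpa using hz
    exact mul_le_of_le_one_right (abs_nonneg _) (pow_le_one₀ (norm_nonneg _) this)
  have heq : Set.EqOn (fun z : ℂ => ‖∑' ν, (diffCoeff α ν : ℂ) * z ^ ν‖)
      (fun z => ‖1 - z‖ ^ α) (Metric.ball 0 1) := by
    intro z hz
    have h1 := (Complex.one_add_cpow_hasFPowerSeriesOnBall_zero (a := (α:ℂ))).hasSum (y := -z)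
      (by
        rw [Metric.mem_eball, edist_zero_right, enorm_neg, ← ofReal_norm, ENNReal.ofReal_lt_one]
        simpa using hz)
    have h2 : ∑' ν, (diffCoeff α ν : ℂ) * z ^ ν = (1 - z) ^ (α:ℂ) := by
      rw [show (1 - z : ℂ) = 1 + (0 + -z) by ring, ← h1.tsum_eq]
      refine tsum_congr fun ν => ?_
      rw [binomialSeries_apply, List.ofFn_const, List.prod_replicate, ← Complex.ofReal_choose,
        ← fracBinom_eq_choose, diffCoeff, neg_pow]
      push_cast
      simp only [smul_eq_mul]; ring
    simp only [h2]
    exact Complex.norm_cpow_real _ _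
  have := heq.of_subset_closure hcont.norm
    (Continuous.continuousOn (Continuous.rpow_const (by fun_prop) fun _ => Or.inr hα.le))
    Metric.ball_subset_closedBall (by rw [closure_ball _ one_ne_zero])
  exact this (by simpa using hz)

/-- The fractional difference multiplies a cosine by `|2 sin (t/2)|^α` up to a phase. -/
theorem exists_phase_hasSum_diffCoeff_cos {α : ℝ} (hα : 0 < α) (t : ℝ) : ∃ θ : ℝ, ∀ u : ℝ,
    HasSum (fun ν : ℕ => diffCoeff α ν * cos (u + (α - ν) * t))
      (|2 * sin (t/2)| ^ α * cos (u + θ)) := by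
  set z : ℂ := Complex.exp (-(t * Complex.I))
  have hz : ‖z‖ = 1 := by
    have := Complex.norm_exp_ofReal_mul_I (-t)
    simpa [z] using this
  set F : ℂ := ∑' ν, (diffCoeff α ν : ℂ) * z ^ ν
  set w : ℂ := Complex.exp ((α * t : ℝ) * Complex.I) * F
  have hF : HasSum (fun ν => (diffCoeff α ν : ℂ) * z ^ ν) F := by
    refine Summable.hasSum (Summable.of_norm ?_)
    simpa [hz] using summable_abs_diffCoeff hα
  have hw : ‖w‖ = |2 * sin (t/2)| ^ α := by
    rw [norm_mul, Complex.norm_exp_ofReal_mul_I, one_mul, norm_tsum_diffCoeff hα hz.le]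
    congr 1
    have h1 : 1 - z = -(Complex.exp (Complex.I * (-t : ℝ)) - 1) := by
      simp only [z]; rw [neg_sub]; congr 2; push_cast; ring
    rw [h1, norm_neg, Complex.norm_exp_I_mul_ofReal_sub_one, Real.norm_eq_abs, neg_div, sin_neg,
      mul_neg, abs_neg]
  refine ⟨w.arg, fun u => ?_⟩
  have h2 := hF.mul_left (Complex.exp ((u : ℝ) * Complex.I) * Complex.exp ((α * t : ℝ) * Complex.I))
  have h3 := Complex.hasSum_re h2
  convert h3 using 1
  · ext ν
    have : Complex.exp ((u : ℝ) * Complex.I) * Complex.exp ((α * t : ℝ) * Complex.I) *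
        ((diffCoeff α ν : ℂ) * z ^ ν) =
        (diffCoeff α ν : ℂ) * Complex.exp ((u + (α - ν) * t : ℝ) * Complex.I) := by
      simp only [z]
      rw [← Complex.exp_nat_mul, mul_left_comm, ← Complex.exp_add, ← Complex.exp_add]
      congr 2; push_cast; ring
    rw [this, Complex.re_ofReal_mul, Complex.exp_ofReal_mul_I_re]
  · have : Complex.exp ((u : ℝ) * Complex.I) * Complex.exp ((α * t : ℝ) * Complex.I) * F =
        (‖w‖ : ℂ) * Complex.exp ((u + w.arg : ℝ) * Complex.I) := by
      rw [mul_assoc]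
      change Complex.exp ((u : ℝ) * Complex.I) * w = _
      conv_lhs => rw [← Complex.norm_mul_exp_arg_mul_I w]
      rw [mul_left_comm, ← Complex.exp_add]
      congr 2; push_cast; ring
    rw [this, Complex.re_ofReal_mul, Complex.exp_ofReal_mul_I_re, hw]

theorem setLIntegral_comp_add_of_periodic {g : ℝ → ℝ≥0∞}
    (hg : Function.Periodic g (2*π)) (t : ℝ) :
    ∫⁻ x in Set.Ioc 0 (2*π), g (x + t) = ∫⁻ x in Set.Ioc 0 (2*π), g x := by
  have h1 : ∫⁻ x in Set.Ioc 0 (2*π), g (x + t) = ∫⁻ x in Set.Ioc t (t + 2*π), g x := by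
    have := (measurePreserving_add_right volume t).setLIntegral_comp_preimage_emb
      (MeasurableEquiv.addRight t).measurableEmbedding g (Set.Ioc t (t + 2*π))
    rw [← this]
    simp
  have : VAddInvariantMeasure (AddSubgroup.zmultiples (2*π)) ℝ volume :=
    ⟨fun c s _ => measure_preimage_add _ _ _⟩
  have h2 : ∫⁻ x in Set.Ioc t (t + 2*π), g x = ∫⁻ x in Set.Ioc 0 (0 + 2*π), g x :=
    (isAddFundamentalDomain_Ioc two_pi_pos t).setLIntegral_eq
      (isAddFundamentalDomain_Ioc two_pi_pos 0) g hg.map_vadd_zmultiples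
  rw [h1, h2, zero_add]

theorem eLpNorm_shift_fst {p : ℝ} (hp : 0 < p) {u : ℝ → ℝ → ℝ}
    (hu : Measurable (Function.uncurry u)) (hper : ∀ y, Function.Periodic (fun x => u x y) (2*π))
    (t : ℝ) :
    eLpNorm (fun z : ℝ × ℝ => u (z.1 + t) z.2) (ENNReal.ofReal p) sqM =
      eLpNorm (Function.uncurry u) (ENNReal.ofReal p) sqM := by
  have hu' : Measurable fun z : ℝ × ℝ => u (z.1 + t) z.2 :=
    hu.comp ((measurable_fst.add_const t).prodMk measurable_snd)
  rw [eLpNorm_eq_lintegral_rpow_enorm_toReal (by simpa using hp) ENNReal.ofReal_ne_top,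
    eLpNorm_eq_lintegral_rpow_enorm_toReal (by simpa using hp) ENNReal.ofReal_ne_top, sqM,
    lintegral_prod_symm' _ (by fun_prop), lintegral_prod_symm' _ (by fun_prop)]
  congr 2
  ext y
  exact setLIntegral_comp_add_of_periodic (g := fun x => ‖u x y‖ₑ ^ (ENNReal.ofReal p).toReal)
    (fun x => congrArg (fun c => ‖c‖ₑ ^ (ENNReal.ofReal p).toReal) (hper y x)) t

theorem eLpNorm_shift_snd {p : ℝ} (hp : 0 < p) {u : ℝ → ℝ → ℝ}
    (hu : Measurable (Function.uncurry u)) (hper : ∀ x, Function.Periodic (u x) (2*π)) (t : ℝ) :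
    eLpNorm (fun z : ℝ × ℝ => u z.1 (z.2 + t)) (ENNReal.ofReal p) sqM =
      eLpNorm (Function.uncurry u) (ENNReal.ofReal p) sqM := by
  have hu' : Measurable fun z : ℝ × ℝ => u z.1 (z.2 + t) :=
    hu.comp (measurable_fst.prodMk (measurable_snd.add_const t))
  rw [eLpNorm_eq_lintegral_rpow_enorm_toReal (by simpa using hp) ENNReal.ofReal_ne_top,
    eLpNorm_eq_lintegral_rpow_enorm_toReal (by simpa using hp) ENNReal.ofReal_ne_top, sqM,
    lintegral_prod _ (by fun_prop), lintegral_prod _ (by fun_prop)]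
  congr 2
  ext x
  exact setLIntegral_comp_add_of_periodic (g := fun y => ‖u x y‖ₑ ^ (ENNReal.ofReal p).toReal)
    (fun y => congrArg (fun c => ‖c‖ₑ ^ (ENNReal.ofReal p).toReal) (hper x y)) t

section TsumBound

variable {X : Type*} {mX : MeasurableSpace X} {μ : Measure X}

theorem eLpNorm_tsum_le_tsum_eLpNorm {q : ℝ≥0∞} (hq : 1 ≤ q) {f : ℕ → X → ℝ}
    (hf : ∀ n, AEStronglyMeasurable (f n) μ) :
    eLpNorm (fun x => ∑' n, f n x) q μ ≤ ∑' n, eLpNorm (f n) q μ := by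
  by_cases htop : ∑' n, eLpNorm (f n) q μ = ⊤
  · rw [htop]; exact le_top
  have hsum := summable_norm_of_tsum_eLpNorm_ne_top hq hf htop
  have hlim : ∀ᵐ x ∂μ, Filter.Tendsto (fun n => (∑ i ∈ Finset.range n, f i) x) Filter.atTop
      (nhds (∑' n, f n x)) := by
    filter_upwards [hsum] with x hx
    simpa only [Finset.sum_apply] using hx.of_norm.hasSum.tendsto_sum_nat
  refine (Lp.eLpNorm_lim_le_liminf_eLpNorm
    (fun n => Finset.aestronglyMeasurable_sum _ fun i _ => hf i) _ hlim).trans ?_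
  refine Filter.liminf_le_of_le (by isBoundedDefault) fun b hb => ?_
  obtain ⟨n, hn⟩ := hb.exists
  exact hn.trans ((eLpNorm_sum_le (fun i _ => hf i) hq).trans (ENNReal.sum_le_tsum _))

theorem eLpNorm_tsum_comp_sub_le {q : ℝ≥0∞} (hq : 1 ≤ q) {c : ℕ → ℝ}
    (hc : Summable fun n => |c n|) {u v : X → ℝ} {τ : ℕ → X → X}
    (hum : ∀ n, AEStronglyMeasurable (fun x => u (τ n x)) μ)
    (hvm : ∀ n, AEStronglyMeasurable (fun x => v (τ n x)) μ)
    (hu : ∀ n, eLpNorm (fun x => u (τ n x)) q μ = eLpNorm u q μ)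
    (hv : ∀ n, eLpNorm (fun x => v (τ n x)) q μ = eLpNorm v q μ)
    (huv : ∀ n, eLpNorm (fun x => u (τ n x) - v (τ n x)) q μ = eLpNorm (fun x => u x - v x) q μ)
    (hu' : eLpNorm u q μ ≠ ⊤) (hv' : eLpNorm v q μ ≠ ⊤) :
    eLpNorm (fun x => ∑' n, c n * u (τ n x) - ∑' n, c n * v (τ n x)) q μ ≤
      ENNReal.ofReal (∑' n, |c n|) * eLpNorm (fun x => u x - v x) q μ := by
  have hcs : ∑' n, ‖c n‖ₑ = ENNReal.ofReal (∑' n, |c n|) := by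
    rw [ENNReal.ofReal_tsum_of_nonneg (fun _ => abs_nonneg _) hc]
    simp only [Real.enorm_eq_ofReal_abs]
  have hsm : ∀ w : X → ℝ, (∀ n, AEStronglyMeasurable (fun x => w (τ n x)) μ) →
      (∀ n, eLpNorm (fun x => w (τ n x)) q μ = eLpNorm w q μ) → eLpNorm w q μ ≠ ⊤ →
      ∀ᵐ x ∂μ, Summable fun n => c n * w (τ n x) := by
    intro w hwm hw hw'
    have := summable_norm_of_tsum_eLpNorm_ne_top (f := fun n x => c n * w (τ n x)) hq
      (fun n => (hwm n).const_mul _) (μ := μ) (by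
        have : ∀ n, eLpNorm (fun x => c n * w (τ n x)) q μ = ‖c n‖ₑ * eLpNorm w q μ := by
          intro n
          rw [← hw n]
          exact eLpNorm_const_smul (c n) (fun x => w (τ n x)) q μ
        simp only [this]
        rw [ENNReal.tsum_mul_right, hcs]
        exact ENNReal.mul_ne_top ENNReal.ofReal_ne_top hw')
    filter_upwards [this] with x hx using hx.of_norm
  have hae : (fun x => ∑' n, c n * u (τ n x) - ∑' n, c n * v (τ n x)) =ᵐ[μ]
      fun x => ∑' n, c n * (u (τ n x) - v (τ n x)) := by
    filter_upwards [hsm u hum hu hu', hsm v hvm hv hv'] with x h1 h2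
    rw [← h1.tsum_sub h2]
    simp only [mul_sub]
  rw [eLpNorm_congr_ae hae]
  refine (eLpNorm_tsum_le_tsum_eLpNorm hq fun n => ((hum n).sub (hvm n)).const_mul _).trans ?_
  rw [← hcs, ← ENNReal.tsum_mul_right]
  refine ENNReal.tsum_le_tsum fun n => ?_
  rw [← huv n]
  exact (eLpNorm_const_smul (c n) (fun x => u (τ n x) - v (τ n x)) q μ).le

end TsumBound

/-- Measurable functions that are `2π`-periodic in each variable, with finite `L_p` norm. -/
structure PerLp (p : ℝ) (u : ℝ → ℝ → ℝ) : Prop where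
  meas : Measurable (Function.uncurry u)
  per_x : ∀ y, Function.Periodic (fun x => u x y) (2*π)
  per_y : ∀ x, Function.Periodic (u x) (2*π)
  ne_top : eLpNorm (Function.uncurry u) (ENNReal.ofReal p) sqM ≠ ⊤

theorem measurable_diffX (α h : ℝ) {u : ℝ → ℝ → ℝ} (hu : Measurable (Function.uncurry u)) :
    Measurable (Function.uncurry (diffX α h u)) := by
  unfold diffX Function.uncurry
  refine Measurable.tsum fun ν => Measurable.const_mul ?_ _
  exact hu.comp ((measurable_fst.add_const _).prodMk measurable_snd)

theorem measurable_diffY (α h : ℝ) {u : ℝ → ℝ → ℝ} (hu : Measurable (Function.uncurry u)) :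
    Measurable (Function.uncurry (diffY α h u)) := by
  unfold diffY Function.uncurry
  refine Measurable.tsum fun ν => Measurable.const_mul ?_ _
  exact hu.comp (measurable_fst.prodMk (measurable_snd.add_const _))

theorem eLpNorm_diffX_sub_le {p α : ℝ} (hp : 1 < p) (hα : 0 < α) (h : ℝ) {u v : ℝ → ℝ → ℝ}
    (hu : PerLp p u) (hv : PerLp p v) :
    eLpNorm (fun z : ℝ × ℝ => diffX α h u z.1 z.2 - diffX α h v z.1 z.2) (ENNReal.ofReal p) sqM ≤
      ENNReal.ofReal (∑' ν, |diffCoeff α ν|) *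
        eLpNorm (fun z : ℝ × ℝ => u z.1 z.2 - v z.1 z.2) (ENNReal.ofReal p) sqM := by
  have hp0 : 0 < p := by linarith
  have hτ : ∀ t : ℝ, Measurable fun z : ℝ × ℝ => (z.1 + t, z.2) := fun t =>
    (measurable_fst.add_const _).prodMk measurable_snd
  refine eLpNorm_tsum_comp_sub_le (u := Function.uncurry u) (v := Function.uncurry v)
    (τ := fun (ν : ℕ) (z : ℝ × ℝ) => (z.1 + (α - ν) * h, z.2))
    (by simpa using ENNReal.ofReal_le_ofReal hp.le)
    (summable_abs_diffCoeff hα) (fun n => (hu.meas.comp (hτ _)).aestronglyMeasurable)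
    (fun n => (hv.meas.comp (hτ _)).aestronglyMeasurable)
    (fun n => eLpNorm_shift_fst hp0 hu.meas hu.per_x _)
    (fun n => eLpNorm_shift_fst hp0 hv.meas hv.per_x _)
    (fun n => eLpNorm_shift_fst hp0 (u := fun x y => u x y - v x y) (hu.meas.sub hv.meas)
      (fun y => (hu.per_x y).sub (hv.per_x y)) _) hu.ne_top hv.ne_top

theorem eLpNorm_diffY_sub_le {p α : ℝ} (hp : 1 < p) (hα : 0 < α) (h : ℝ) {u v : ℝ → ℝ → ℝ}
    (hu : PerLp p u) (hv : PerLp p v) :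
    eLpNorm (fun z : ℝ × ℝ => diffY α h u z.1 z.2 - diffY α h v z.1 z.2) (ENNReal.ofReal p) sqM ≤
      ENNReal.ofReal (∑' ν, |diffCoeff α ν|) *
        eLpNorm (fun z : ℝ × ℝ => u z.1 z.2 - v z.1 z.2) (ENNReal.ofReal p) sqM := by
  have hp0 : 0 < p := by linarith
  have hτ : ∀ t : ℝ, Measurable fun z : ℝ × ℝ => (z.1, z.2 + t) := fun t =>
    measurable_fst.prodMk (measurable_snd.add_const _)
  refine eLpNorm_tsum_comp_sub_le (u := Function.uncurry u) (v := Function.uncurry v)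
    (τ := fun (ν : ℕ) (z : ℝ × ℝ) => (z.1, z.2 + (α - ν) * h))
    (by simpa using ENNReal.ofReal_le_ofReal hp.le)
    (summable_abs_diffCoeff hα) (fun n => (hu.meas.comp (hτ _)).aestronglyMeasurable)
    (fun n => (hv.meas.comp (hτ _)).aestronglyMeasurable)
    (fun n => eLpNorm_shift_snd hp0 hu.meas hu.per_y _)
    (fun n => eLpNorm_shift_snd hp0 hv.meas hv.per_y _)
    (fun n => eLpNorm_shift_snd hp0 (u := fun x y => u x y - v x y) (hu.meas.sub hv.meas)
      (fun x => (hu.per_y x).sub (hv.per_y x)) _) hu.ne_top hv.ne_top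

theorem perLp_zero (p : ℝ) : PerLp p fun _ _ => 0 where
  meas := measurable_const
  per_x _ _ := rfl
  per_y _ _ := rfl
  ne_top := by
    have : Function.uncurry (fun (_ _ : ℝ) => (0:ℝ)) = 0 := by ext; rfl
    rw [this, eLpNorm_zero]; exact ENNReal.zero_ne_top

theorem PerLp.diffY {p α : ℝ} (hp : 1 < p) (hα : 0 < α) (h : ℝ) {u : ℝ → ℝ → ℝ}
    (hu : PerLp p u) : PerLp p (diffY α h u) where
  meas := measurable_diffY α h hu.meas
  per_x y x := by
    simp only [_root_.diffY]
    exact tsum_congr fun ν => congrArg (fun c => (-1) ^ ν * fracBinom α ν * c) (hu.per_x _ x)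
  per_y x y := by
    simp only [_root_.diffY]
    refine tsum_congr fun ν => ?_
    rw [show y + 2*π + (α - ν) * h = (y + (α - ν) * h) + 2*π by ring, hu.per_y x]
  ne_top := by
    have := eLpNorm_diffY_sub_le hp hα h hu (perLp_zero p)
    simp only [sub_zero] at this
    have h0 : ∀ x y, _root_.diffY α h (fun _ _ => 0) x y = 0 := by simp [_root_.diffY]
    simp only [h0, sub_zero] at this
    exact ne_top_of_le_ne_top (ENNReal.mul_ne_top ENNReal.ofReal_ne_top hu.ne_top) this

/-- The mixed difference operator is Lipschitz in `L_p`. -/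
theorem eLpNorm_diffX_diffY_sub_le {p α₁ α₂ : ℝ} (hp : 1 < p) (hα₁ : 0 < α₁) (hα₂ : 0 < α₂) :
    ∃ M : ℝ, ∀ (h₁ h₂ : ℝ) (u v : ℝ → ℝ → ℝ), PerLp p u → PerLp p v →
    eLpNorm (Function.uncurry (diffX α₁ h₁ (diffY α₂ h₂ u)) -
      Function.uncurry (diffX α₁ h₁ (diffY α₂ h₂ v))) (ENNReal.ofReal p) sqM ≤
      ENNReal.ofReal M *
        eLpNorm (Function.uncurry u - Function.uncurry v) (ENNReal.ofReal p) sqM := by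
  refine ⟨(∑' ν, |diffCoeff α₁ ν|) * (∑' ν, |diffCoeff α₂ ν|), fun h₁ h₂ u v hu hv => ?_⟩
  rw [ENNReal.ofReal_mul (tsum_nonneg fun _ => abs_nonneg _), mul_assoc]
  exact (eLpNorm_diffX_sub_le hp hα₁ h₁ (hu.diffY hp hα₂ h₂) (hv.diffY hp hα₂ h₂)).trans
    (mul_le_mul_right (eLpNorm_diffY_sub_le hp hα₂ h₂ hu hv) _)

theorem perLp_lacPoly (p : ℝ) (N : ℕ) (b : ℕ → ℕ → ℝ) (φ ψ : ℕ → ℝ) :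
    PerLp p (lacPoly N b φ ψ) where
  meas := (lacPoly_continuous N b φ ψ).measurable
  per_x y x := by
    simp only [lacPoly]
    refine Finset.sum_congr rfl fun i _ => Finset.sum_congr rfl fun j _ => ?_
    rw [show (2:ℝ)^i * (x + 2*π) + φ i = (2^i * x + φ i) + ((2^i : ℕ):ℝ) * (2*π) by
        push_cast; ring, cos_add_nat_mul_two_pi]
  per_y x y := by
    simp only [lacPoly]
    refine Finset.sum_congr rfl fun i _ => Finset.sum_congr rfl fun j _ => ?_
    rw [show (2:ℝ)^j * (y + 2*π) + ψ j = (2^j * y + ψ j) + ((2^j : ℕ):ℝ) * (2*π) by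
        push_cast; ring, cos_add_nat_mul_two_pi]
  ne_top := (memLp_lacPoly N b φ ψ _).eLpNorm_ne_top

/-- The amplitude of the fractional difference of `cos (2^i x)`. -/
def amp (α h : ℝ) (i : ℕ) : ℝ := |2 * sin (2^i * h / 2)| ^ α

theorem exists_phases_hasSum {α : ℝ} (hα : 0 < α) (h : ℝ) (φ : ℕ → ℝ) : ∃ θ : ℕ → ℝ,
    ∀ (i : ℕ) (x : ℝ), HasSum (fun ν : ℕ => (-1 : ℝ)^ν * fracBinom α ν *
      cos (2^i * (x + (α - ν) * h) + φ i)) (amp α h i * cos (2^i * x + θ i)) := by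
  choose θ hθ using fun i : ℕ => exists_phase_hasSum_diffCoeff_cos hα (2^i * h)
  refine ⟨fun i => φ i + θ i, fun i x => ?_⟩
  have := hθ i (2^i * x + φ i)
  convert this using 1
  · ext ν
    unfold diffCoeff
    congr 2; ring
  · unfold amp
    rw [add_assoc]

theorem hasSum_of_eq {f g : ℕ → ℝ} {a b : ℝ} (hf : HasSum f a) (h : ∀ n, g n = f n)
    (hab : b = a) : HasSum g b := by
  rw [hab, funext h]; exact hf

theorem exists_phases_diff_lacPoly {α₁ α₂ : ℝ} (hα₁ : 0 < α₁) (hα₂ : 0 < α₂) (h₁ h₂ : ℝ)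
    (φ ψ : ℕ → ℝ) : ∃ φ' ψ' : ℕ → ℝ, ∀ (N : ℕ) (b : ℕ → ℕ → ℝ),
      diffX α₁ h₁ (diffY α₂ h₂ (lacPoly N b φ ψ)) =
        lacPoly N (fun i j => b i j * amp α₁ h₁ i * amp α₂ h₂ j) φ' ψ' := by
  obtain ⟨φ', hφ⟩ := exists_phases_hasSum hα₁ h₁ φ
  obtain ⟨ψ', hψ⟩ := exists_phases_hasSum hα₂ h₂ ψ
  refine ⟨φ', ψ', fun N b => ?_⟩
  have hY : diffY α₂ h₂ (lacPoly N b φ ψ) = lacPoly N (fun i j => b i j * amp α₂ h₂ j) φ ψ' := by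
    ext x y
    refine HasSum.tsum_eq ?_
    have := hasSum_sum (s := Finset.range N) fun i _ => hasSum_sum (s := Finset.range N) fun j _ =>
      (hψ j y).mul_left (b i j * cos (2^i * x + φ i))
    refine hasSum_of_eq this (fun ν => ?_) ?_
    · simp only [lacPoly, Finset.mul_sum]
      exact Finset.sum_congr rfl fun i _ => Finset.sum_congr rfl fun j _ => by ring
    · simp only [lacPoly]
      exact Finset.sum_congr rfl fun i _ => Finset.sum_congr rfl fun j _ => by ring
  rw [hY]
  ext x y
  refine HasSum.tsum_eq ?_
  have := hasSum_sum (s := Finset.range N) fun i _ => hasSum_sum (s := Finset.range N) fun j _ =>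
      (hφ i x).mul_left (b i j * amp α₂ h₂ j * cos (2^j * y + ψ' j))
  refine hasSum_of_eq this (fun ν => ?_) ?_
  · simp only [lacPoly, Finset.mul_sum]
    exact Finset.sum_congr rfl fun i _ => Finset.sum_congr rfl fun j _ => by ring
  · simp only [lacPoly]
    exact Finset.sum_congr rfl fun i _ => Finset.sum_congr rfl fun j _ => by ring

theorem integral_mul_fourier_eq_zero {g : ℝ → ℝ} (hg : IntegrableOn g (Set.Ioc 0 (2*π)))
    (hc : ∀ k : ℕ, ∫ x in (0:ℝ)..(2*π), g x * cos (k * x) = 0)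
    (hs : ∀ k : ℕ, ∫ x in (0:ℝ)..(2*π), g x * sin (k * x) = 0) (n : ℤ) :
    ∫ x in Set.Ioc 0 (2*π), (g x : ℂ) * fourier (T := 2*π) n (x : AddCircle (2*π)) = 0 := by
  have h2 : (0:ℝ) ≤ 2*π := by positivity
  simp only [intervalIntegral.integral_of_le h2] at hc hs
  have hcn : ∫ x in Set.Ioc 0 (2*π), g x * cos (n * x) = 0 := by
    obtain ⟨k, rfl | rfl⟩ := n.eq_nat_or_neg
    · exact_mod_cast hc k
    · push_cast
      simp only [neg_mul, cos_neg]
      exact hc k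
  have hsn : ∫ x in Set.Ioc 0 (2*π), g x * sin (n * x) = 0 := by
    obtain ⟨k, rfl | rfl⟩ := n.eq_nat_or_neg
    · exact_mod_cast hs k
    · push_cast
      simp only [neg_mul, sin_neg, mul_neg, integral_neg, neg_eq_zero]
      exact hs k
  have hic : IntegrableOn (fun x => g x * cos (n * x)) (Set.Ioc 0 (2*π)) :=
    Integrable.mul_bdd (c := 1) hg (by fun_prop) (ae_of_all _ fun x => abs_cos_le_one _)
  have his : IntegrableOn (fun x => g x * sin (n * x)) (Set.Ioc 0 (2*π)) :=
    Integrable.mul_bdd (c := 1) hg (by fun_prop) (ae_of_all _ fun x => abs_sin_le_one _)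
  have hfun : ∀ x : ℝ, (g x : ℂ) * fourier (T := 2*π) n (x : AddCircle (2*π)) =
      ((g x * cos (n * x) : ℝ) : ℂ) + ((g x * sin (n * x) : ℝ) : ℂ) * Complex.I := by
    intro x
    rw [fourier_coe_apply, show 2 * (π:ℂ) * Complex.I * n * x / ((2 * π : ℝ) : ℂ) =
      ((n * x : ℝ) : ℂ) * Complex.I by
        have : (π : ℂ) ≠ 0 := by exact_mod_cast pi_ne_zero
        push_cast; field_simp, Complex.exp_mul_I]
    push_cast
    ring
  simp only [hfun]
  rw [integral_add hic.ofReal (his.ofReal.mul_const _), integral_mul_const,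
    integral_complex_ofReal, integral_complex_ofReal, hcn, hsn]
  simp

theorem integral_mul_continuousMap_eq_zero {g : ℝ → ℝ} (hg : IntegrableOn g (Set.Ioc 0 (2*π)))
    (hc : ∀ k : ℕ, ∫ x in (0:ℝ)..(2*π), g x * cos (k * x) = 0)
    (hs : ∀ k : ℕ, ∫ x in (0:ℝ)..(2*π), g x * sin (k * x) = 0) (Φ : C(AddCircle (2*π), ℂ)) :
    ∫ x in Set.Ioc 0 (2*π), (g x : ℂ) * Φ (x : AddCircle (2*π)) = 0 := by
  have : Fact (0 < 2*π) := ⟨two_pi_pos⟩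
  have hint : ∀ Ψ : C(AddCircle (2*π), ℂ),
      IntegrableOn (fun x : ℝ => (g x : ℂ) * Ψ (x : AddCircle (2*π))) (Set.Ioc 0 (2*π)) := fun Ψ =>
    Integrable.mul_bdd (c := ‖Ψ‖) hg.ofReal
      (Ψ.continuous.comp (AddCircle.continuous_mk' _)).aestronglyMeasurable
      (ae_of_all _ fun x => Ψ.norm_coe_le_norm _)
  let L : C(AddCircle (2*π), ℂ) →L[ℂ] ℂ := LinearMap.mkContinuous
    { toFun := fun Ψ => ∫ x in Set.Ioc 0 (2*π), (g x : ℂ) * Ψ (x : AddCircle (2*π))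
      map_add' := fun Ψ₁ Ψ₂ => by
        rw [← integral_add (hint Ψ₁) (hint Ψ₂)]
        simp only [ContinuousMap.add_apply, mul_add]
      map_smul' := fun c Ψ => by
        simp only [ContinuousMap.smul_apply, smul_eq_mul, RingHom.id_apply]
        rw [← integral_const_mul]
        congr 1; ext x; ring }
    (∫ x in Set.Ioc 0 (2*π), |g x|) fun Ψ => by
      rw [← integral_mul_const]
      refine norm_integral_le_of_norm_le (hg.abs.mul_const _) (ae_of_all _ fun x => ?_)
      rw [norm_mul, Complex.norm_real]
      exact mul_le_mul_of_nonneg_left (Ψ.norm_coe_le_norm _) (norm_nonneg _)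
  have hle : (Submodule.span ℂ (Set.range (@fourier (2*π)))).topologicalClosure ≤
      LinearMap.ker (L : C(AddCircle (2*π), ℂ) →ₗ[ℂ] ℂ) := by
    refine Submodule.topologicalClosure_minimal _ ?_ L.isClosed_ker
    rw [Submodule.span_le]
    rintro _ ⟨n, rfl⟩
    exact integral_mul_fourier_eq_zero hg hc hs n
  rw [span_fourier_closure_eq_top] at hle
  exact hle (Submodule.mem_top (x := Φ))

/-- An integrable function with vanishing Fourier coefficients vanishes almost everywhere. -/
theorem ae_eq_zero_of_fourier {g : ℝ → ℝ} (hg : IntegrableOn g (Set.Ioc 0 (2*π)))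
    (hc : ∀ k : ℕ, ∫ x in (0:ℝ)..(2*π), g x * cos (k * x) = 0)
    (hs : ∀ k : ℕ, ∫ x in (0:ℝ)..(2*π), g x * sin (k * x) = 0) :
    ∀ᵐ x ∂(volume.restrict (Set.Ioc 0 (2*π))), g x = 0 := by
  have : Fact (0 < 2*π) := ⟨two_pi_pos⟩
  rw [← restrict_Ioo_eq_restrict_Ioc, ae_restrict_iff' measurableSet_Ioo]
  refine isOpen_Ioo.ae_eq_zero_of_integral_contDiff_smul_eq_zero
    ((hg.mono_set Set.Ioo_subset_Ioc_self).locallyIntegrableOn) fun φ hφ _ hsupp => ?_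
  have hout : ∀ x, x ∉ Set.Ioo 0 (2*π) → φ x = 0 := fun x hx => by
    by_contra h
    exact hx (hsupp (subset_tsupport _ h))
  have hΦ : Continuous (AddCircle.liftIco (2*π) 0 fun x => (φ x : ℂ)) := by
    refine AddCircle.liftIco_continuous ?_ ?_
    · rw [hout 0 (by simp), hout _ (by simp)]
    · exact (Complex.continuous_ofReal.comp hφ.continuous).continuousOn
  have := integral_mul_continuousMap_eq_zero hg hc hs ⟨_, hΦ⟩
  rw [← setIntegral_congr_set Ioo_ae_eq_Ioc, setIntegral_congr_fun (g := fun x => ((φ x * g x : ℝ) : ℂ))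
    measurableSet_Ioo, integral_complex_ofReal, Complex.ofReal_eq_zero,
    setIntegral_eq_integral_of_forall_compl_eq_zero] at this
  · exact this
  · intro x hx
    rw [hout x hx, zero_mul]
  · intro x hx
    simp only [ContinuousMap.coe_mk]
    rw [AddCircle.liftIco_coe_apply ⟨hx.1.le, by simpa using hx.2⟩]
    push_cast; ring

/-- Uniqueness of double Fourier series. -/
theorem ae_eq_zero_of_double_fourier {g : ℝ × ℝ → ℝ} (hg : Integrable g sqM)
    (h : ∀ (k l : ℕ) (u v : ℝ → ℝ), (u = (fun x => cos (k * x)) ∨ u = fun x => sin (k * x)) →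
      (v = (fun x => cos (l * x)) ∨ v = fun x => sin (l * x)) →
      ∫ z, g z * u z.1 * v z.2 ∂sqM = 0) : g =ᵐ[sqM] 0 := by
  have h2 : (0:ℝ) ≤ 2*π := by positivity
  have hint : ∀ (k : ℕ) (u : ℝ → ℝ), (u = (fun x => cos (k * x)) ∨ u = fun x => sin (k * x)) →
      Integrable (fun z => g z * u z.1) sqM ∧ Continuous u ∧ ∀ x, |u x| ≤ 1 := by
    rintro k u (rfl | rfl)
    · exact ⟨Integrable.mul_bdd (c := 1) hg (by fun_prop) (ae_of_all _ fun x => abs_cos_le_one _),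
        by fun_prop, fun x => abs_cos_le_one _⟩
    · exact ⟨Integrable.mul_bdd (c := 1) hg (by fun_prop) (ae_of_all _ fun x => abs_sin_le_one _),
        by fun_prop, fun x => abs_sin_le_one _⟩
  have hz : ∀ (k : ℕ) (u : ℝ → ℝ), (u = (fun x => cos (k * x)) ∨ u = fun x => sin (k * x)) →
      ∀ᵐ y ∂(volume.restrict (Set.Ioc 0 (2*π))), ∫ x in (0:ℝ)..(2*π), g (x, y) * u x = 0 := by
    intro k u hu
    obtain ⟨h1, -, -⟩ := hint k u hu
    have hF := h1.integral_prod_right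
    simp only [← intervalIntegral.integral_of_le h2] at hF
    have hv : ∀ (l : ℕ) (v : ℝ → ℝ), (v = (fun x => cos (l * x)) ∨ v = fun x => sin (l * x)) →
        ∫ y in (0:ℝ)..(2*π), (∫ x in (0:ℝ)..(2*π), g (x, y) * u x) * v y = 0 := by
      intro l v hv
      obtain ⟨-, hvc, hvb⟩ := hint l v hv
      have := h k l u v hu hv
      rw [integral_sqM_symm (g := fun z => g z * u z.1 * v z.2) (Integrable.mul_bdd (c := 1) h1
        (hvc.comp continuous_snd).aestronglyMeasurable (ae_of_all _ fun z => hvb _))] at this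
      simpa only [intervalIntegral.integral_mul_const] using this
    exact ae_eq_zero_of_fourier hF (fun l => hv l _ (Or.inl rfl)) (fun l => hv l _ (Or.inr rfl))
  have hc := ae_all_iff.2 fun k : ℕ => hz k _ (Or.inl rfl)
  have hs := ae_all_iff.2 fun k : ℕ => hz k _ (Or.inr rfl)
  have hmain : ∀ᵐ y ∂(volume.restrict (Set.Ioc 0 (2*π))),
      ∀ᵐ x ∂(volume.restrict (Set.Ioc 0 (2*π))), g (x, y) = 0 := by
    filter_upwards [hc, hs, hg.prod_left_ae] with y h3 h4 h5
    exact ae_eq_zero_of_fourier h5 h3 h4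
  have h0 : ∫⁻ z, ‖g z‖ₑ ∂sqM = 0 := by
    rw [sqM, lintegral_prod_symm _ hg.1.enorm]
    rw [lintegral_congr_ae (g := fun _ => 0), lintegral_zero]
    filter_upwards [hmain] with y hy
    rw [lintegral_congr_ae (g := fun _ => 0), lintegral_zero]
    filter_upwards [hy] with x hx
    rw [hx, enorm_zero]
  rw [lintegral_eq_zero_iff' hg.1.enorm] at h0
  filter_upwards [h0] with z hz
  simpa using hz

theorem sum_range_ite_lt {N M : ℕ} (h : N ≤ M) (c : ℕ → ℕ → ℝ) :
    ∑ i ∈ Finset.range M, ∑ j ∈ Finset.range M, (if i < N ∧ j < N then c i j else 0) =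
      ∑ i ∈ Finset.range N, ∑ j ∈ Finset.range N, c i j := by
  have hs := Finset.range_subset_range.2 h
  rw [← Finset.sum_subset hs]
  · refine Finset.sum_congr rfl fun i hi => ?_
    rw [← Finset.sum_subset hs]
    · refine Finset.sum_congr rfl fun j hj => ?_
      rw [if_pos ⟨Finset.mem_range.1 hi, Finset.mem_range.1 hj⟩]
    · intro j _ hj
      rw [if_neg fun h => hj (Finset.mem_range.2 h.2)]
  · intro i _ hi
    refine Finset.sum_eq_zero fun j _ => ?_
    rw [if_neg fun h => hi (Finset.mem_range.2 h.1)]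

theorem lacPoly_sub (N : ℕ) (a b : ℕ → ℕ → ℝ) (φ ψ : ℕ → ℝ) :
    Function.uncurry (lacPoly N a φ ψ) - Function.uncurry (lacPoly N b φ ψ) =
      Function.uncurry (lacPoly N (fun i j => a i j - b i j) φ ψ) := by
  ext z
  simp only [Function.uncurry, Pi.sub_apply, lacPoly, sub_mul, Finset.sum_sub_distrib]

theorem lacPoly_eq_lacPoly_of_le {N M : ℕ} (h : N ≤ M) (b : ℕ → ℕ → ℝ) (φ ψ : ℕ → ℝ) :
    lacPoly N b φ ψ = lacPoly M (fun i j => if i < N ∧ j < N then b i j else 0) φ ψ := by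
  ext x y
  simp only [lacPoly]
  rw [← sum_range_ite_lt h]
  refine Finset.sum_congr rfl fun i _ => Finset.sum_congr rfl fun j _ => ?_
  split_ifs <;> simp

theorem PerLp.memLp {p : ℝ} {u : ℝ → ℝ → ℝ} (hu : PerLp p u) :
    MemLp (Function.uncurry u) (ENNReal.ofReal p) sqM :=
  ⟨hu.meas.aestronglyMeasurable, hu.ne_top.lt_top⟩

theorem one_le_ofReal {p : ℝ} (hp : 1 < p) : 1 ≤ ENNReal.ofReal p := by
  simpa using ENNReal.ofReal_le_ofReal hp.le

theorem MemLp0.perLp {p : ℝ} (hp : 1 < p) {f : ℝ → ℝ → ℝ} (hf : MemLp0 p f) : PerLp p f where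
  meas := hf.meas
  per_x := hf.periodic_x
  per_y := hf.periodic_y
  ne_top := by
    rw [← Lp2Norm_eq_eLpNorm (by linarith) hf.meas]
    exact hf.norm_ne_top

theorem integrable_mul_mul {g : ℝ × ℝ → ℝ} (hg : Integrable g sqM) {u v : ℝ → ℝ}
    (hu : Continuous u) (hv : Continuous v) (hu1 : ∀ x, |u x| ≤ 1) (hv1 : ∀ x, |v x| ≤ 1) :
    Integrable (fun z => g z * u z.1 * v z.2) sqM :=
  Integrable.mul_bdd (c := 1) (Integrable.mul_bdd (c := 1) hg
    (hu.comp continuous_fst).aestronglyMeasurable (ae_of_all _ fun _ => hu1 _))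
    (hv.comp continuous_snd).aestronglyMeasurable (ae_of_all _ fun _ => hv1 _)

theorem integral_cos_pow_mul_cos (i k : ℕ) :
    ∫ x in (0:ℝ)..(2*π), cos (2^i * x) * cos (k * x) = if k = 2^i then π else 0 := by
  have key : ∀ (m : ℤ), m ≠ 0 → ∫ x in (0:ℝ)..(2*π), cos (m * x) = 0 := by
    intro m hm
    have hm' : (m:ℝ) ≠ 0 := by exact_mod_cast hm
    rw [intervalIntegral.integral_comp_mul_left (fun x => cos x) hm', integral_cos]
    simpa using Or.inr (sin_int_mul_pi (m * 2) ▸ by congr 1; push_cast; ring)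
  have hprod : ∀ x : ℝ, cos (2^i * x) * cos (k * x) =
      (1/2) * cos (((2^i + k : ℤ) : ℝ) * x) + (1/2) * cos (((2^i - k : ℤ) : ℝ) * x) := by
    intro x
    push_cast
    rw [add_mul, sub_mul, cos_add, cos_sub]
    ring
  simp only [hprod]
  rw [intervalIntegral.integral_add (Continuous.intervalIntegrable (by fun_prop) _ _)
    (Continuous.intervalIntegrable (by fun_prop) _ _), intervalIntegral.integral_const_mul,
    intervalIntegral.integral_const_mul, key _ (by positivity)]
  split_ifs with h
  · subst h
    simp
  · rw [key]
    · simp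
    · rw [sub_ne_zero]
      exact fun h' => h (by exact_mod_cast h'.symm)

theorem integral_cos_pow_mul_sin (i k : ℕ) :
    ∫ x in (0:ℝ)..(2*π), cos (2^i * x) * sin (k * x) = 0 := by
  have key : ∀ (m : ℤ), ∫ x in (0:ℝ)..(2*π), sin (m * x) = 0 := by
    intro m
    rcases eq_or_ne m 0 with rfl | hm
    · simp
    have hm' : (m:ℝ) ≠ 0 := by exact_mod_cast hm
    rw [intervalIntegral.integral_comp_mul_left (fun x => sin x) hm', integral_sin]
    simp [cos_int_mul_two_pi]
  have hprod : ∀ x : ℝ, cos (2^i * x) * sin (k * x) =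
      (1/2) * sin (((2^i + k : ℤ) : ℝ) * x) - (1/2) * sin (((2^i - k : ℤ) : ℝ) * x) := by
    intro x
    push_cast
    rw [add_mul, sub_mul, sin_add, sin_sub]
    ring
  simp only [hprod]
  rw [intervalIntegral.integral_sub (Continuous.intervalIntegrable (by fun_prop) _ _)
    (Continuous.intervalIntegrable (by fun_prop) _ _), intervalIntegral.integral_const_mul,
    intervalIntegral.integral_const_mul, key, key]
  simp

theorem integral_lacPoly_mul_mul (N : ℕ) (b : ℕ → ℕ → ℝ) {u v : ℝ → ℝ} (hu : Continuous u)
    (hv : Continuous v) (hu1 : ∀ x, |u x| ≤ 1) (hv1 : ∀ x, |v x| ≤ 1) :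
    ∫ z, Function.uncurry (lacPoly N b 0 0) z * u z.1 * v z.2 ∂sqM =
      ∑ i ∈ Finset.range N, ∑ j ∈ Finset.range N, b i j *
        ((∫ x in (0:ℝ)..(2*π), cos (2^i * x) * u x) *
          ∫ y in (0:ℝ)..(2*π), cos (2^j * y) * v y) := by
  have hint : ∀ i j, Integrable (fun z : ℝ × ℝ =>
      b i j * ((cos (2^i * z.1) * u z.1) * (cos (2^j * z.2) * v z.2))) sqM := by
    intro i j
    refine Integrable.const_mul ?_ _
    rw [← memLp_one_iff_integrable]
    refine memLp_of_continuous_of_bound (by fun_prop) (C := 1) (fun z => ?_) _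
    simp only [abs_mul]
    exact mul_le_one₀ (mul_le_one₀ (abs_cos_le_one _) (abs_nonneg _) (hu1 _)) (by positivity)
      (mul_le_one₀ (abs_cos_le_one _) (abs_nonneg _) (hv1 _))
  have hexp : ∀ z : ℝ × ℝ, Function.uncurry (lacPoly N b 0 0) z * u z.1 * v z.2 =
      ∑ i ∈ Finset.range N, ∑ j ∈ Finset.range N,
        b i j * ((cos (2^i * z.1) * u z.1) * (cos (2^j * z.2) * v z.2)) := by
    intro z
    simp only [Function.uncurry, lacPoly, Finset.sum_mul, Pi.zero_apply, add_zero]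
    exact Finset.sum_congr rfl fun i _ => Finset.sum_congr rfl fun j _ => by ring
  simp only [hexp]
  rw [integral_finsetSum _ fun i _ => integrable_finsetSum _ fun j _ => hint i j]
  refine Finset.sum_congr rfl fun i _ => ?_
  rw [integral_finsetSum _ fun j _ => hint i j]
  refine Finset.sum_congr rfl fun j _ => ?_
  rw [integral_sqM (hint i j)]
  simp only [intervalIntegral.integral_const_mul, intervalIntegral.integral_mul_const]

theorem integral_mul_lacPoly_eq_sum {g : ℝ × ℝ → ℝ} (hg : Integrable g sqM) (N : ℕ)
    (b : ℕ → ℕ → ℝ) :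
    ∫ z, g z * Function.uncurry (lacPoly N b 0 0) z ∂sqM =
      ∑ i ∈ Finset.range N, ∑ j ∈ Finset.range N, b i j *
        ∫ z, g z * cos (((2^i : ℕ) : ℝ) * z.1) * cos (((2^j : ℕ) : ℝ) * z.2) ∂sqM := by
  have hint : ∀ i j : ℕ, Integrable (fun z => b i j * (g z *
      cos (((2^i : ℕ) : ℝ) * z.1) * cos (((2^j : ℕ) : ℝ) * z.2))) sqM := fun i j =>
    (integrable_mul_mul hg (u := fun x => cos (((2^i : ℕ) : ℝ) * x))
      (v := fun x => cos (((2^j : ℕ) : ℝ) * x)) (by fun_prop) (by fun_prop)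
      (fun _ => abs_cos_le_one _) (fun _ => abs_cos_le_one _)).const_mul _
  have hexp : ∀ z, g z * Function.uncurry (lacPoly N b 0 0) z =
      ∑ i ∈ Finset.range N, ∑ j ∈ Finset.range N, b i j * (g z *
      cos (((2^i : ℕ) : ℝ) * z.1) * cos (((2^j : ℕ) : ℝ) * z.2)) := by
    intro z
    simp only [Function.uncurry, lacPoly, Finset.mul_sum, Pi.zero_apply, add_zero]
    refine Finset.sum_congr rfl fun i _ => Finset.sum_congr rfl fun j _ => ?_
    push_cast; ring
  simp only [hexp]
  rw [integral_finsetSum _ fun i _ => integrable_finsetSum _ fun j _ => hint i j]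
  refine Finset.sum_congr rfl fun i _ => ?_
  rw [integral_finsetSum _ fun j _ => hint i j]
  exact Finset.sum_congr rfl fun j _ => integral_const_mul _ _

/-- A trigonometric monomial of one variable. -/
def IsTrig (k : ℕ) (u : ℝ → ℝ) : Prop := u = (fun x => cos (k * x)) ∨ u = fun x => sin (k * x)

theorem IsTrig.continuous {k : ℕ} {u : ℝ → ℝ} (h : IsTrig k u) : Continuous u := by
  rcases h with rfl | rfl <;> fun_prop

theorem IsTrig.abs_le_one {k : ℕ} {u : ℝ → ℝ} (h : IsTrig k u) (x : ℝ) : |u x| ≤ 1 := by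
  rcases h with rfl | rfl
  exacts [abs_cos_le_one _, abs_sin_le_one _]

section Lambda

variable {p : ℝ} {f : ℝ → ℝ → ℝ} {lam : ℕ → ℕ → ℝ}

theorem InLambdaClass.integrable (hp : 1 < p) (hf : InLambdaClass p f lam) :
    Integrable (Function.uncurry f) sqM :=
  (hf.1.perLp hp).memLp.integrable (one_le_ofReal hp)

theorem InLambdaClass.integral_cos_mul_cos (hp : 1 < p) (hf : InLambdaClass p f lam) (k l : ℕ) :
    ∫ z, Function.uncurry f z * cos (k * z.1) * cos (l * z.2) ∂sqM = π ^ 2 * fourierCC f k l := by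
  rw [integral_sqM (integrable_mul_mul (hf.integrable hp) (u := fun x => cos (k * x))
    (v := fun x => cos (l * x)) (by fun_prop) (by fun_prop) (fun _ => abs_cos_le_one _)
    (fun _ => abs_cos_le_one _)), fourierCC]
  field_simp
  rfl

theorem InLambdaClass.integral_eventually_eq (hp : 1 < p) (hf : InLambdaClass p f lam) {k l : ℕ}
    {u v : ℝ → ℝ} (hu : IsTrig k u) (hv : IsTrig l v) :
    ∀ᶠ N in Filter.atTop, ∫ z, Function.uncurry f z * u z.1 * v z.2 ∂sqM =
      ∫ z, Function.uncurry (lacPoly N lam 0 0) z * u z.1 * v z.2 ∂sqM := by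
  have hI := integral_sqM (integrable_mul_mul (hf.integrable hp) hu.continuous hv.continuous
    hu.abs_le_one hv.abs_le_one)
  have hpi : (1 / π ^ 2) ≠ 0 := by positivity
  simp only [integral_lacPoly_mul_mul _ _ hu.continuous hv.continuous hu.abs_le_one hv.abs_le_one]
  obtain ⟨h0, h1, h2, h3⟩ := hf
  rcases hu with rfl | rfl
  · rcases hv with rfl | rfl
    · simp only [integral_cos_pow_mul_cos]
      by_cases hkl : ∃ μ₁ μ₂ : ℕ, k = 2^μ₁ ∧ l = 2^μ₂
      · obtain ⟨m, n, rfl, rfl⟩ := hkl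
        filter_upwards [Filter.eventually_gt_atTop (max m n)] with N hN
        have hinj : ∀ a b : ℕ, (2:ℕ)^a = 2^b ↔ a = b := fun a b =>
          (Nat.pow_right_injective le_rfl).eq_iff
        have := InLambdaClass.integral_cos_mul_cos hp ⟨h0, h1, h2, h3⟩ (2^m) (2^n)
        rw [this, h1]
        simp only [hinj, mul_ite, ite_mul, zero_mul, mul_zero]
        simp only [Finset.sum_ite_eq, Finset.mem_range]
        simp only [if_pos (lt_of_le_of_lt (le_max_right m n) hN), Finset.sum_ite_eq,
          Finset.mem_range, if_pos (lt_of_le_of_lt (le_max_left m n) hN)]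
        ring
      · refine Filter.Eventually.of_forall fun N => ?_
        have := InLambdaClass.integral_cos_mul_cos hp ⟨h0, h1, h2, h3⟩ k l
        rw [this, h2 k l hkl, mul_zero]
        refine (Finset.sum_eq_zero fun i _ => Finset.sum_eq_zero fun j _ => ?_).symm
        by_cases hk : k = 2^i
        · rw [if_neg (fun hl : l = 2^j => hkl ⟨i, j, hk, hl⟩), mul_zero, mul_zero]
        · rw [if_neg hk, zero_mul, mul_zero]
    · refine Filter.Eventually.of_forall fun N => ?_
      rw [hI]
      simp only [integral_cos_pow_mul_sin, mul_zero, Finset.sum_const_zero]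
      exact (mul_eq_zero.1 (h3 k l).2.1).resolve_left hpi
  · refine Filter.Eventually.of_forall fun N => ?_
    rw [hI]
    simp only [integral_cos_pow_mul_sin, zero_mul, mul_zero, Finset.sum_const_zero]
    rcases hv with rfl | rfl
    · exact (mul_eq_zero.1 (h3 k l).1).resolve_left hpi
    · exact (mul_eq_zero.1 (h3 k l).2.2).resolve_left hpi

theorem InLambdaClass.integral_mul_lacPoly (hp : 1 < p) (hf : InLambdaClass p f lam) (N : ℕ)
    (b : ℕ → ℕ → ℝ) :
    ∫ z, Function.uncurry f z * Function.uncurry (lacPoly N b 0 0) z ∂sqM =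
      π ^ 2 * ∑ i ∈ Finset.range N, ∑ j ∈ Finset.range N, lam i j * b i j := by
  simp only [integral_mul_lacPoly_eq_sum (hf.integrable hp), hf.integral_cos_mul_cos hp, hf.2.1,
    Finset.mul_sum]
  exact Finset.sum_congr rfl fun i _ => Finset.sum_congr rfl fun j _ => by ring

theorem InLambdaClass.exists_sum_sq_le (hp : 1 < p) (hf : InLambdaClass p f lam) : ∃ K : ℝ, ∀ N,
    ∑ i ∈ Finset.range N, ∑ j ∈ Finset.range N, lam i j ^ 2 ≤ K := by
  obtain ⟨C, -, hC⟩ := sqrt_sum_sq_le_eLpNorm hp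
  have htop : ENNReal.ofReal C * eLpNorm (Function.uncurry f) (ENNReal.ofReal p) sqM ≠ ⊤ :=
    ENNReal.mul_ne_top ENNReal.ofReal_ne_top (hf.1.perLp hp).ne_top
  refine ⟨(ENNReal.ofReal C * eLpNorm (Function.uncurry f) (ENNReal.ofReal p) sqM).toReal ^ 2,
    fun N => ?_⟩
  have h := hC N lam 0 0 _ (hf.integrable hp).1 (by
    rw [hf.integral_mul_lacPoly hp]
    simp only [sq, le_refl])
  rw [ENNReal.ofReal_le_iff_le_toReal htop] at h
  exact (Real.sqrt_le_left ENNReal.toReal_nonneg).1 h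

theorem monotone_sum_sq (c : ℕ → ℕ → ℝ) :
    Monotone fun N => ∑ i ∈ Finset.range N, ∑ j ∈ Finset.range N, c i j ^ 2 := by
  intro N M h
  have hs := Finset.range_subset_range.2 h
  exact (Finset.sum_le_sum fun i _ => Finset.sum_le_sum_of_subset_of_nonneg hs fun j _ _ =>
    sq_nonneg _).trans (Finset.sum_le_sum_of_subset_of_nonneg hs fun i _ _ =>
      Finset.sum_nonneg fun j _ => sq_nonneg _)

theorem sum_sq_sub_truncation {N M : ℕ} (h : N ≤ M) (c : ℕ → ℕ → ℝ) :
    ∑ i ∈ Finset.range M, ∑ j ∈ Finset.range M, (c i j - if i < N ∧ j < N then c i j else 0) ^ 2 =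
      ∑ i ∈ Finset.range M, ∑ j ∈ Finset.range M, c i j ^ 2 -
        ∑ i ∈ Finset.range N, ∑ j ∈ Finset.range N, c i j ^ 2 := by
  rw [← sum_range_ite_lt h, ← Finset.sum_sub_distrib]
  refine Finset.sum_congr rfl fun i _ => ?_
  rw [← Finset.sum_sub_distrib]
  refine Finset.sum_congr rfl fun j _ => ?_
  split_ifs <;> ring

/-- The square partial sums of the Fourier series of `f ∈ Λ_p` converge to `f` in `L_p`. -/
theorem InLambdaClass.tendsto_eLpNorm_sub_lacPoly (hp : 1 < p) (hf : InLambdaClass p f lam) :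
    Filter.Tendsto (fun N => eLpNorm (Function.uncurry f - Function.uncurry (lacPoly N lam 0 0))
      (ENNReal.ofReal p) sqM) Filter.atTop (nhds 0) := by
  have : Fact (1 ≤ ENNReal.ofReal p) := ⟨one_le_ofReal hp⟩
  obtain ⟨K, hK⟩ := hf.exists_sum_sq_le hp
  obtain ⟨C, hC, hup⟩ := eLpNorm_lacPoly_le (q := p) (by linarith)
  set s : ℕ → ℝ := fun N => ∑ i ∈ Finset.range N, ∑ j ∈ Finset.range N, lam i j ^ 2
  have hmono : Monotone s := monotone_sum_sq lam
  have hbdd : BddAbove (Set.range s) := ⟨K, by rintro _ ⟨N, rfl⟩; exact hK N⟩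
  have hlim := tendsto_atTop_ciSup hmono hbdd
  set S := ⨆ N, s N
  have hfm := (hf.1.perLp hp).memLp
  have hm : ∀ N, MemLp (Function.uncurry f - Function.uncurry (lacPoly N lam 0 0))
    (ENNReal.ofReal p) sqM := fun N => hfm.sub (memLp_lacPoly N lam 0 0 _)
  have hdist : ∀ n m, n ≤ m → dist (hm n).toLp (hm m).toLp ≤ C * √(S - s n) := by
    intro n m hnm
    rw [dist_eq_norm, ← MemLp.toLp_sub, Lp.norm_toLp, sub_sub_sub_cancel_left,
      lacPoly_eq_lacPoly_of_le hnm lam, lacPoly_sub]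
    refine ENNReal.toReal_le_of_le_ofReal (by positivity) ((hup _ _ _ _).trans ?_)
    rw [sum_sq_sub_truncation hnm]
    gcongr
    exact le_ciSup hbdd m
  have hcau : CauchySeq fun N => (hm N).toLp := by
    refine cauchySeq_of_le_tendsto_0 (fun N => C * √(S - s N)) (fun n m N hn hm' => ?_) ?_
    · have hsq : ∀ k, N ≤ k → C * √(S - s k) ≤ C * √(S - s N) := fun k hk => by
        have := hmono hk
        gcongr
      rcases le_total n m with h | h
      · exact (hdist n m h).trans (hsq n hn)
      · rw [dist_comm]
        exact (hdist m n h).trans (hsq m hm')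
    · have := ((hlim.const_sub S).sqrt).const_mul C
      simpa using this
  obtain ⟨H, hH⟩ := cauchySeq_tendsto_of_complete hcau
  have hHe : Filter.Tendsto (fun N => eLpNorm ((Function.uncurry f -
      Function.uncurry (lacPoly N lam 0 0)) - ⇑H) (ENNReal.ofReal p) sqM) Filter.atTop (nhds 0) := by
    have := (Lp.tendsto_Lp_iff_tendsto_eLpNorm'' (fun N => Function.uncurry f -
      Function.uncurry (lacPoly N lam 0 0)) hm H (Lp.memLp H)).1 (by simpa using hH)
    exact this
  have hHint : Integrable H sqM := (Lp.memLp H).integrable (one_le_ofReal hp)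
  have hH1 : Filter.Tendsto (fun N => eLpNorm ((Function.uncurry f -
      Function.uncurry (lacPoly N lam 0 0)) - ⇑H) 1 sqM) Filter.atTop (nhds 0) := by
    refine tendsto_of_tendsto_of_tendsto_of_le_of_le tendsto_const_nhds (?_ : Filter.Tendsto
      (fun N => eLpNorm ((Function.uncurry f - Function.uncurry (lacPoly N lam 0 0)) - ⇑H)
        (ENNReal.ofReal p) sqM * sqM Set.univ ^ (1 / (1:ℝ≥0∞).toReal -
          1 / (ENNReal.ofReal p).toReal)) _ _) (fun _ => zero_le)
      fun N => eLpNorm_le_eLpNorm_mul_rpow_measure_univ (one_le_ofReal hp)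
        ((hm N).sub (Lp.memLp H)).1
    have h0 : sqM Set.univ ^ (1 / (1:ℝ≥0∞).toReal - 1 / (ENNReal.ofReal p).toReal) ≠ ⊤ := by
      refine ENNReal.rpow_ne_top_of_nonneg ?_ (measure_ne_top _ _)
      rw [ENNReal.toReal_ofReal (by linarith), ENNReal.toReal_one, sub_nonneg]
      exact one_div_le_one_div_of_le one_pos hp.le
    simpa using ENNReal.Tendsto.mul_const hHe (Or.inr h0)
  have hzero : (H : ℝ × ℝ → ℝ) =ᵐ[sqM] 0 := by
    refine ae_eq_zero_of_double_fourier hHint fun k l u v hu hv => ?_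
    have hu' : IsTrig k u := hu
    have hv' : IsTrig l v := hv
    have hPi : ∀ N, Integrable (Function.uncurry (lacPoly N lam 0 0)) sqM := fun N =>
      memLp_one_iff_integrable.1 (memLp_lacPoly N lam 0 0 1)
    have hi : ∀ g : ℝ × ℝ → ℝ, Integrable g sqM → Integrable (fun z => g z * u z.1 * v z.2) sqM :=
      fun g hg => integrable_mul_mul hg hu'.continuous hv'.continuous hu'.abs_le_one hv'.abs_le_one
    have ht := tendsto_integral_of_L1' (fun z => H z * u z.1 * v z.2) (hi _ hHint).1
      (F := fun N z => (Function.uncurry f - Function.uncurry (lacPoly N lam 0 0)) z *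
        u z.1 * v z.2) (l := Filter.atTop)
      (Filter.Eventually.of_forall fun N => hi _ ((hf.integrable hp).sub (hPi N))) (by
        refine tendsto_of_tendsto_of_tendsto_of_le_of_le tendsto_const_nhds hH1
          (fun _ => zero_le) fun N => eLpNorm_mono fun z => ?_
        simp only [Pi.sub_apply, ← sub_mul, norm_mul, Real.norm_eq_abs]
        rw [mul_assoc]
        exact mul_le_of_le_one_right (abs_nonneg _)
          (mul_le_one₀ (hu'.abs_le_one _) (abs_nonneg _) (hv'.abs_le_one _)))
    refine tendsto_nhds_unique ht (tendsto_const_nhds.congr' ?_)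
    filter_upwards [hf.integral_eventually_eq hp hu' hv'] with N hN
    simp only [Pi.sub_apply, sub_mul]
    rw [integral_sub (hi _ (hf.integrable hp)) (hi _ (hPi N)), hN, sub_self]
  refine hHe.congr fun N => eLpNorm_congr_ae ?_
  filter_upwards [hzero] with z hz
  simp [hz]

end Lambda

/-- The sum of the squares of a double sequence. -/
def sqSum (b : ℕ → ℕ → ℝ) : ℝ≥0∞ := ∑' z : ℕ × ℕ, ENNReal.ofReal (b z.1 z.2 ^ 2)

theorem ofReal_sum_sq (N : ℕ) (b : ℕ → ℕ → ℝ) :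
    ENNReal.ofReal (∑ i ∈ Finset.range N, ∑ j ∈ Finset.range N, b i j ^ 2) =
      ∑ z ∈ Finset.range N ×ˢ Finset.range N, ENNReal.ofReal (b z.1 z.2 ^ 2) := by
  rw [← Finset.sum_product', ENNReal.ofReal_sum_of_nonneg fun _ _ => sq_nonneg _]

theorem sqSum_le {b : ℕ → ℕ → ℝ} {B : ℝ≥0∞}
    (h : ∀ N, ENNReal.ofReal (∑ i ∈ Finset.range N, ∑ j ∈ Finset.range N, b i j ^ 2) ≤ B) :
    sqSum b ≤ B := by
  refine ENNReal.summable.tsum_le_of_sum_le fun s => ?_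
  obtain ⟨N, hN⟩ : ∃ N, s ⊆ Finset.range N ×ˢ Finset.range N := by
    obtain ⟨A, hA⟩ := (s.image Prod.fst).exists_nat_subset_range
    obtain ⟨B, hB⟩ := (s.image Prod.snd).exists_nat_subset_range
    refine ⟨max A B, fun z hz => ?_⟩
    have h1 := Finset.mem_range.1 (hA (Finset.mem_image_of_mem _ hz))
    have h2 := Finset.mem_range.1 (hB (Finset.mem_image_of_mem _ hz))
    exact Finset.mem_product.2 ⟨Finset.mem_range.2 (h1.trans_le (le_max_left _ _)),
      Finset.mem_range.2 (h2.trans_le (le_max_right _ _))⟩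
  exact (Finset.sum_le_sum_of_subset hN).trans ((ofReal_sum_sq N b).symm.le.trans (h N))

theorem ofReal_sqrt_sum_le (b : ℕ → ℕ → ℝ) (N : ℕ) :
    ENNReal.ofReal √(∑ i ∈ Finset.range N, ∑ j ∈ Finset.range N, b i j ^ 2) ≤
      sqSum b ^ (1/2 : ℝ) := by
  rw [Real.sqrt_eq_rpow, ← ENNReal.ofReal_rpow_of_nonneg
    (Finset.sum_nonneg fun _ _ => Finset.sum_nonneg fun _ _ => sq_nonneg _) (by norm_num),
    ofReal_sum_sq]
  exact ENNReal.rpow_le_rpow (ENNReal.sum_le_tsum _) (by norm_num)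

theorem sqSum_rpow_le {b : ℕ → ℕ → ℝ} {B : ℝ≥0∞}
    (h : ∀ N, ENNReal.ofReal √(∑ i ∈ Finset.range N, ∑ j ∈ Finset.range N, b i j ^ 2) ≤ B) :
    sqSum b ^ (1/2 : ℝ) ≤ B := by
  have : sqSum b ≤ B ^ (2:ℝ) := by
    refine sqSum_le fun N => ?_
    have h0 : 0 ≤ ∑ i ∈ Finset.range N, ∑ j ∈ Finset.range N, b i j ^ 2 :=
      Finset.sum_nonneg fun _ _ => Finset.sum_nonneg fun _ _ => sq_nonneg _
    have := ENNReal.rpow_le_rpow (h N) (z := 2) (by norm_num)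
    rwa [ENNReal.ofReal_rpow_of_nonneg (Real.sqrt_nonneg _) (by norm_num), Real.rpow_two,
      Real.sq_sqrt h0] at this
  calc sqSum b ^ (1/2 : ℝ) ≤ (B ^ (2:ℝ)) ^ (1/2 : ℝ) := ENNReal.rpow_le_rpow this (by norm_num)
    _ = B := by rw [← ENNReal.rpow_mul]; norm_num

/-- The `L_p` norm of the sum of a lacunary series is equivalent to the `ℓ_2` norm of its
coefficients. -/
theorem exists_eLpNorm_equiv_sqSum {p : ℝ} (hp : 1 < p) : ∃ C : ℝ, 0 < C ∧
    ∀ (b : ℕ → ℕ → ℝ) (φ ψ : ℕ → ℝ) (D : ℝ × ℝ → ℝ), AEStronglyMeasurable D sqM →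
      Filter.Tendsto (fun N => eLpNorm (D - Function.uncurry (lacPoly N b φ ψ))
        (ENNReal.ofReal p) sqM) Filter.atTop (nhds 0) →
      eLpNorm D (ENNReal.ofReal p) sqM ≤ ENNReal.ofReal C * sqSum b ^ (1/2 : ℝ) ∧
      sqSum b ^ (1/2 : ℝ) ≤ ENNReal.ofReal C * eLpNorm D (ENNReal.ofReal p) sqM := by
  obtain ⟨C₁, hC₁, h₁⟩ := eLpNorm_lacPoly_le (q := p) (by linarith)
  obtain ⟨C₂, hC₂, h₂⟩ := sqrt_sum_sq_le_eLpNorm hp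
  have hp1 := one_le_ofReal hp
  refine ⟨max C₁ C₂, by positivity, fun b φ ψ D hD hlim => ⟨?_, ?_⟩⟩
  · refine (?_ : _ ≤ ENNReal.ofReal C₁ * sqSum b ^ (1/2 : ℝ)).trans
      (mul_le_mul_left (ENNReal.ofReal_le_ofReal (le_max_left _ _)) _)
    have ht := hlim.add_const (ENNReal.ofReal C₁ * sqSum b ^ (1/2 : ℝ))
    rw [zero_add] at ht
    refine ge_of_tendsto' ht fun N => ?_
    have hm := (memLp_lacPoly N b φ ψ (ENNReal.ofReal p)).1
    calc _ = eLpNorm ((D - Function.uncurry (lacPoly N b φ ψ)) +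
          Function.uncurry (lacPoly N b φ ψ)) (ENNReal.ofReal p) sqM := by rw [sub_add_cancel]
      _ ≤ _ := (eLpNorm_add_le (hD.sub hm) hm hp1).trans (add_le_add_right ((h₁ _ _ _ _).trans (by
          rw [ENNReal.ofReal_mul hC₁.le]
          exact mul_le_mul_right (ofReal_sqrt_sum_le b N) _)) _)
  · refine (?_ : _ ≤ ENNReal.ofReal C₂ * eLpNorm D (ENNReal.ofReal p) sqM).trans
      (mul_le_mul_left (ENNReal.ofReal_le_ofReal (le_max_right _ _)) _)
    refine sqSum_rpow_le fun N₀ => ?_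
    have ht := ENNReal.Tendsto.const_mul
      (hlim.add_const (eLpNorm D (ENNReal.ofReal p) sqM)) (a := ENNReal.ofReal C₂)
        (Or.inr ENNReal.ofReal_ne_top)
    rw [zero_add] at ht
    refine ge_of_tendsto ht ?_
    filter_upwards [Filter.eventually_ge_atTop N₀] with N hN
    have hm := (memLp_lacPoly N b φ ψ (ENNReal.ofReal p)).1
    calc _ ≤ ENNReal.ofReal √(∑ i ∈ Finset.range N, ∑ j ∈ Finset.range N, b i j ^ 2) :=
          ENNReal.ofReal_le_ofReal (Real.sqrt_le_sqrt (monotone_sum_sq b hN))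
      _ ≤ ENNReal.ofReal C₂ *
          eLpNorm (Function.uncurry (lacPoly N b φ ψ)) (ENNReal.ofReal p) sqM :=
        h₂ N b φ ψ _ hm (by rw [integral_lacPoly_mul_lacPoly]; simp only [sq, le_refl])
      _ ≤ _ := by
        refine mul_le_mul_right ?_ _
        calc _ = eLpNorm (D - (D - Function.uncurry (lacPoly N b φ ψ))) (ENNReal.ofReal p) sqM := by
              rw [sub_sub_cancel]
          _ ≤ _ := (eLpNorm_sub_le hD (hD.sub hm) hp1).trans (add_comm _ _).le

theorem exists_diff_equiv {p α₁ α₂ : ℝ} (hp : 1 < p) (hα₁ : 0 < α₁) (hα₂ : 0 < α₂) :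
    ∃ C : ℝ, 0 < C ∧ ∀ (f : ℝ → ℝ → ℝ) (lam : ℕ → ℕ → ℝ), InLambdaClass p f lam →
      ∀ h₁ h₂ : ℝ,
      Lp2Norm p (diffX α₁ h₁ (diffY α₂ h₂ f)) ≤ ENNReal.ofReal C *
        sqSum (fun i j => lam i j * amp α₁ h₁ i * amp α₂ h₂ j) ^ (1/2 : ℝ) ∧
      sqSum (fun i j => lam i j * amp α₁ h₁ i * amp α₂ h₂ j) ^ (1/2 : ℝ) ≤
        ENNReal.ofReal C * Lp2Norm p (diffX α₁ h₁ (diffY α₂ h₂ f)) := by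
  obtain ⟨C, hC, h⟩ := exists_eLpNorm_equiv_sqSum hp
  obtain ⟨M, hM⟩ := eLpNorm_diffX_diffY_sub_le hp hα₁ hα₂
  refine ⟨C, hC, fun f lam hf h₁ h₂ => ?_⟩
  obtain ⟨φ', ψ', hφ⟩ := exists_phases_diff_lacPoly hα₁ hα₂ h₁ h₂ 0 0
  have hm : Measurable (Function.uncurry (diffX α₁ h₁ (diffY α₂ h₂ f))) :=
    measurable_diffX _ _ (measurable_diffY _ _ hf.1.meas)
  rw [Lp2Norm_eq_eLpNorm (by linarith) hm]
  refine h _ φ' ψ' _ hm.aestronglyMeasurable ?_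
  have ht := ENNReal.Tendsto.const_mul (hf.tendsto_eLpNorm_sub_lacPoly hp)
    (a := ENNReal.ofReal M) (Or.inr ENNReal.ofReal_ne_top)
  rw [mul_zero] at ht
  refine tendsto_of_tendsto_of_tendsto_of_le_of_le tendsto_const_nhds ht (fun _ => zero_le)
    fun N => ?_
  simp only
  rw [← hφ N lam]
  exact hM _ _ _ _ (hf.1.perLp hp) (perLp_lacPoly _ _ _ _ _)

theorem TrigPolyX.memLp {p : ℝ} (hp : 0 < p) {m : ℕ} {T : ℝ → ℝ → ℝ} (hT : TrigPolyX p m T) :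
    MemLp (Function.uncurry T) (ENNReal.ofReal p) sqM :=
  ⟨hT.1.aestronglyMeasurable, by rw [← Lp2Norm_eq_eLpNorm hp hT.1]; exact hT.2.1.lt_top⟩

theorem TrigPolyY.memLp {p : ℝ} (hp : 0 < p) {m : ℕ} {T : ℝ → ℝ → ℝ} (hT : TrigPolyY p m T) :
    MemLp (Function.uncurry T) (ENNReal.ofReal p) sqM :=
  ⟨hT.1.aestronglyMeasurable, by rw [← Lp2Norm_eq_eLpNorm hp hT.1]; exact hT.2.1.lt_top⟩

theorem integral_trigPoly_mul_cos_eq_zero {m i : ℕ} (hi : m < 2^i) (a b : ℕ → ℝ) :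
    ∫ x in (0:ℝ)..(2*π), (∑ k ∈ Finset.range (m+1), (a k * cos (k * x) + b k * sin (k * x))) *
      cos (((2^i : ℕ) : ℝ) * x) = 0 := by
  have hexp : ∀ x : ℝ, (∑ k ∈ Finset.range (m+1), (a k * cos (k * x) + b k * sin (k * x))) *
      cos (((2^i : ℕ) : ℝ) * x) = ∑ k ∈ Finset.range (m+1),
        (a k * (cos (2^i * x) * cos (k * x)) + b k * (cos (2^i * x) * sin (k * x))) := by
    intro x
    rw [Finset.sum_mul]
    refine Finset.sum_congr rfl fun k _ => ?_
    push_cast; ring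
  simp only [hexp]
  rw [intervalIntegral.integral_finsetSum fun k _ =>
    Continuous.intervalIntegrable (by fun_prop) _ _]
  refine Finset.sum_eq_zero fun k hk => ?_
  rw [intervalIntegral.integral_add (Continuous.intervalIntegrable (by fun_prop) _ _)
    (Continuous.intervalIntegrable (by fun_prop) _ _), intervalIntegral.integral_const_mul,
    intervalIntegral.integral_const_mul, integral_cos_pow_mul_cos, integral_cos_pow_mul_sin,
    if_neg]
  · simp
  · rintro rfl
    exact absurd (Finset.mem_range.1 hk) (by omega)

theorem TrigPolyX.integral_mul_cos_eq_zero {p : ℝ} (hp : 1 < p) {m : ℕ} {T : ℝ → ℝ → ℝ}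
    (hT : TrigPolyX p m T) {i : ℕ} (hi : m < 2^i) (l : ℕ) :
    ∫ z, Function.uncurry T z * cos (((2^i : ℕ) : ℝ) * z.1) * cos (l * z.2) ∂sqM = 0 := by
  have hint := integrable_mul_mul ((hT.memLp (by linarith)).integrable (one_le_ofReal hp))
    (u := fun x => cos (((2^i : ℕ) : ℝ) * x)) (v := fun x => cos (l * x)) (by fun_prop)
    (by fun_prop) (fun _ => abs_cos_le_one _) (fun _ => abs_cos_le_one _)
  obtain ⟨-, -, -, a, b, hab⟩ := hT
  rw [integral_sqM_symm hint]
  simp only [Function.uncurry, hab, intervalIntegral.integral_mul_const,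
    integral_trigPoly_mul_cos_eq_zero hi (fun k => a k _) (fun k => b k _), zero_mul,
    intervalIntegral.integral_zero]

theorem TrigPolyY.integral_mul_cos_eq_zero {p : ℝ} (hp : 1 < p) {m : ℕ} {T : ℝ → ℝ → ℝ}
    (hT : TrigPolyY p m T) {j : ℕ} (hj : m < 2^j) (k : ℕ) :
    ∫ z, Function.uncurry T z * cos (k * z.1) * cos (((2^j : ℕ) : ℝ) * z.2) ∂sqM = 0 := by
  have hint := integrable_mul_mul ((hT.memLp (by linarith)).integrable (one_le_ofReal hp))
    (u := fun x => cos (k * x)) (v := fun x => cos (((2^j : ℕ) : ℝ) * x)) (by fun_prop)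
    (by fun_prop) (fun _ => abs_cos_le_one _) (fun _ => abs_cos_le_one _)
  obtain ⟨-, -, -, a, b, hab⟩ := hT
  rw [integral_sqM hint]
  have hz : ∀ x : ℝ, ∫ y in (0:ℝ)..(2*π), (∑ l ∈ Finset.range (m+1),
      (a l x * cos (l * y) + b l x * sin (l * y))) * cos (k * x) *
        cos (((2^j : ℕ) : ℝ) * y) = 0 := by
    intro x
    simp only [mul_right_comm _ (cos (k * x))]
    rw [intervalIntegral.integral_mul_const,
      integral_trigPoly_mul_cos_eq_zero hj (fun l => a l x) (fun l => b l x), zero_mul]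
  simp only [Function.uncurry, hab, hz, intervalIntegral.integral_zero]

theorem trigPolyX_lacPoly {p : ℝ} (hp : 0 < p) (m N : ℕ) {b : ℕ → ℕ → ℝ}
    (hb : ∀ i j, m < 2^i → b i j = 0) : TrigPolyX p m (lacPoly N b 0 0) := by
  have h := perLp_lacPoly p N b 0 0
  refine ⟨h.meas, by rw [Lp2Norm_eq_eLpNorm hp h.meas]; exact h.ne_top, h.per_y,
    fun k y => ∑ i ∈ Finset.range N, if 2^i = k then
      ∑ j ∈ Finset.range N, b i j * cos (2^j * y) else 0, 0, fun x y => ?_⟩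
  simp only [lacPoly, Pi.zero_apply, add_zero, zero_mul, Finset.sum_mul, ite_mul]
  rw [Finset.sum_comm (s := Finset.range (m+1))]
  refine Finset.sum_congr rfl fun i _ => ?_
  rw [Finset.sum_ite_eq]
  split_ifs with hi
  · refine Finset.sum_congr rfl fun j _ => ?_
    push_cast; ring
  · refine Finset.sum_eq_zero fun j _ => ?_
    rw [hb i j (by simpa using hi)]
    simp

theorem trigPolyY_lacPoly {p : ℝ} (hp : 0 < p) (m N : ℕ) {b : ℕ → ℕ → ℝ}
    (hb : ∀ i j, m < 2^j → b i j = 0) : TrigPolyY p m (lacPoly N b 0 0) := by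
  have h := perLp_lacPoly p N b 0 0
  refine ⟨h.meas, by rw [Lp2Norm_eq_eLpNorm hp h.meas]; exact h.ne_top, h.per_x,
    fun k x => ∑ j ∈ Finset.range N, if 2^j = k then
      ∑ i ∈ Finset.range N, b i j * cos (2^i * x) else 0, 0, fun x y => ?_⟩
  simp only [lacPoly, Pi.zero_apply, add_zero, zero_mul, Finset.sum_mul, ite_mul]
  rw [Finset.sum_comm, Finset.sum_comm (s := Finset.range (m+1))]
  refine Finset.sum_congr rfl fun j _ => ?_
  rw [Finset.sum_ite_eq]
  split_ifs with hj
  · refine Finset.sum_congr rfl fun i _ => ?_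
    push_cast; ring
  · refine Finset.sum_eq_zero fun i _ => ?_
    rw [hb i j (by simpa using hj)]
    simp

/-- The coefficients of frequencies exceeding `m₁` and `m₂`. -/
def highPart (m₁ m₂ : ℕ) (lam : ℕ → ℕ → ℝ) (i j : ℕ) : ℝ :=
  if m₁ < 2^i ∧ m₂ < 2^j then lam i j else 0

theorem exists_Yapprox_equiv {p : ℝ} (hp : 1 < p) : ∃ C : ℝ, 0 < C ∧
    ∀ (f : ℝ → ℝ → ℝ) (lam : ℕ → ℕ → ℝ), InLambdaClass p f lam → ∀ m₁ m₂ : ℕ,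
      Yapprox p m₁ m₂ f ≤ ENNReal.ofReal C * sqSum (highPart m₁ m₂ lam) ^ (1/2 : ℝ) ∧
      sqSum (highPart m₁ m₂ lam) ^ (1/2 : ℝ) ≤ ENNReal.ofReal C * Yapprox p m₁ m₂ f := by
  have hp0 : 0 < p := by linarith
  obtain ⟨C₁, hC₁, h₁⟩ := eLpNorm_lacPoly_le hp0
  obtain ⟨C₂, hC₂, h₂⟩ := sqrt_sum_sq_le_eLpNorm hp
  refine ⟨max C₁ C₂, by positivity, fun f lam hf m₁ m₂ => ⟨?_, ?_⟩⟩
  · refine (?_ : _ ≤ ENNReal.ofReal C₁ * sqSum (highPart m₁ m₂ lam) ^ (1/2 : ℝ)).trans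
      (mul_le_mul_left (ENNReal.ofReal_le_ofReal (le_max_left _ _)) _)
    have ht := (hf.tendsto_eLpNorm_sub_lacPoly hp).add_const
      (ENNReal.ofReal C₁ * sqSum (highPart m₁ m₂ lam) ^ (1/2 : ℝ))
    rw [zero_add] at ht
    refine ge_of_tendsto' ht fun N => ?_
    set c₁ : ℕ → ℕ → ℝ := fun i j => if m₁ < 2^i then 0 else lam i j with hc₁
    set c₂ : ℕ → ℕ → ℝ := fun i j => if m₂ < 2^j then 0 else lam i j - c₁ i j with hc₂
    have hT₁ : TrigPolyX p m₁ (lacPoly N c₁ 0 0) :=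
      trigPolyX_lacPoly hp0 m₁ N fun i j h => if_pos h
    have hT₂ : TrigPolyY p m₂ (lacPoly N c₂ 0 0) :=
      trigPolyY_lacPoly hp0 m₂ N fun i j h => if_pos h
    have hsplit : Function.uncurry (fun x y => f x y - lacPoly N c₁ 0 0 x y -
        lacPoly N c₂ 0 0 x y) = (Function.uncurry f - Function.uncurry (lacPoly N lam 0 0)) +
          Function.uncurry (lacPoly N (highPart m₁ m₂ lam) 0 0) := by
      have : highPart m₁ m₂ lam = fun i j => (lam i j - c₁ i j) - c₂ i j := by
        ext i j
        by_cases h1 : m₁ < 2^i <;> by_cases h2 : m₂ < 2^j <;> simp [highPart, hc₁, hc₂, h1, h2]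
      rw [this, ← lacPoly_sub N (fun i j => lam i j - c₁ i j), ← lacPoly_sub]
      ext z
      simp only [Function.uncurry, Pi.add_apply, Pi.sub_apply]
      ring
    refine (iInf₂_le_of_le _ hT₁ (iInf₂_le _ hT₂)).trans ?_
    have hmeas : Measurable (Function.uncurry (fun x y => f x y - lacPoly N c₁ 0 0 x y -
        lacPoly N c₂ 0 0 x y)) := (hf.1.meas.sub hT₁.1).sub hT₂.1
    rw [Lp2Norm_eq_eLpNorm hp0 hmeas, hsplit]
    refine (eLpNorm_add_le ((hf.integrable hp).1.sub (memLp_lacPoly N _ _ _ 1).1)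
      (memLp_lacPoly N _ _ _ 1).1 (one_le_ofReal hp)).trans (add_le_add_right ?_ _)
    refine (h₁ _ _ _ _).trans ?_
    rw [ENNReal.ofReal_mul hC₁.le]
    exact mul_le_mul_right (ofReal_sqrt_sum_le _ N) _
  · refine (?_ : _ ≤ ENNReal.ofReal C₂ * Yapprox p m₁ m₂ f).trans
      (mul_le_mul_left (ENNReal.ofReal_le_ofReal (le_max_right _ _)) _)
    have h0 : ENNReal.ofReal C₂ ≠ 0 := by simpa using hC₂
    rw [← ENNReal.div_le_iff' h0 ENNReal.ofReal_ne_top]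
    refine le_iInf₂ fun T₁ hT₁ => le_iInf₂ fun T₂ hT₂ => ?_
    rw [ENNReal.div_le_iff' h0 ENNReal.ofReal_ne_top]
    have hmeas : Measurable (Function.uncurry (fun x y => f x y - T₁ x y - T₂ x y)) :=
      (hf.1.meas.sub hT₁.1).sub hT₂.1
    rw [Lp2Norm_eq_eLpNorm hp0 hmeas]
    refine sqSum_rpow_le fun N => h₂ N _ 0 0 _ hmeas.aestronglyMeasurable ?_
    have hi₁ := (hT₁.memLp hp0).integrable (one_le_ofReal hp)
    have hi₂ := (hT₂.memLp hp0).integrable (one_le_ofReal hp)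
    have hi : ∀ g : ℝ × ℝ → ℝ, Integrable g sqM → Integrable (fun z => g z *
        Function.uncurry (lacPoly N (highPart m₁ m₂ lam) 0 0) z) sqM := fun g hg => by
      obtain ⟨K, hK⟩ := exists_abs_lacPoly_le N (highPart m₁ m₂ lam) 0 0
      exact Integrable.mul_bdd (c := K) hg (memLp_lacPoly N _ _ _ 1).1 (ae_of_all _ hK)
    have hexp : ∀ z, Function.uncurry (fun x y => f x y - T₁ x y - T₂ x y) z *
        Function.uncurry (lacPoly N (highPart m₁ m₂ lam) 0 0) z =
        Function.uncurry f z * Function.uncurry (lacPoly N (highPart m₁ m₂ lam) 0 0) z -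
        Function.uncurry T₁ z * Function.uncurry (lacPoly N (highPart m₁ m₂ lam) 0 0) z -
        Function.uncurry T₂ z * Function.uncurry (lacPoly N (highPart m₁ m₂ lam) 0 0) z := by
      intro z
      simp only [Function.uncurry]
      ring
    simp only [hexp]
    have hsub : Integrable (fun z => Function.uncurry f z *
        Function.uncurry (lacPoly N (highPart m₁ m₂ lam) 0 0) z - Function.uncurry T₁ z *
        Function.uncurry (lacPoly N (highPart m₁ m₂ lam) 0 0) z) sqM :=
      (hi _ (hf.integrable hp)).sub (hi _ hi₁)
    rw [integral_sub hsub (hi _ hi₂),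
      integral_sub (hi _ (hf.integrable hp)) (hi _ hi₁), hf.integral_mul_lacPoly hp,
      integral_mul_lacPoly_eq_sum hi₁, integral_mul_lacPoly_eq_sum hi₂]
    have hz : ∀ i j, highPart m₁ m₂ lam i j * (∫ z, Function.uncurry T₁ z *
        cos (((2^i : ℕ) : ℝ) * z.1) * cos (((2^j : ℕ) : ℝ) * z.2) ∂sqM) = 0 ∧
        highPart m₁ m₂ lam i j * (∫ z, Function.uncurry T₂ z *
        cos (((2^i : ℕ) : ℝ) * z.1) * cos (((2^j : ℕ) : ℝ) * z.2) ∂sqM) = 0 ∧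
        lam i j * highPart m₁ m₂ lam i j = highPart m₁ m₂ lam i j ^ 2 := by
      intro i j
      by_cases h : m₁ < 2^i ∧ m₂ < 2^j
      · rw [hT₁.integral_mul_cos_eq_zero hp h.1, hT₂.integral_mul_cos_eq_zero hp h.2,
          highPart, if_pos h]
        simp [sq]
      · simp [highPart, if_neg h]
    simp only [(hz _ _).1, (hz _ _).2.1, (hz _ _).2.2, Finset.sum_const_zero, sub_zero, le_refl]

theorem one_sub_max_mul_le_rpow {β t : ℝ} (ht0 : 0 ≤ t) (ht1 : t ≤ 1) :
    1 - max 1 β * t ≤ (1 - t) ^ β := by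
  rcases le_total 1 β with h | h
  · rw [max_eq_right h]
    have := one_add_mul_self_le_rpow_one_add (s := -t) (by linarith) h
    simpa [sub_eq_add_neg] using this
  · rw [max_eq_left h, one_mul]
    exact Real.self_le_rpow_of_le_one (by linarith) (by linarith) h

theorem rpow_le_one_sub_min_mul {β t : ℝ} (hβ : 0 < β) (ht0 : 0 ≤ t) (ht1 : t ≤ 1) :
    (1 - t) ^ β ≤ 1 - min 1 β * t := by
  rcases le_total 1 β with h | h
  · rw [min_eq_left h, one_mul]
    exact Real.rpow_le_self_of_le_one (by linarith) (by linarith) h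
  · rw [min_eq_right h]
    have := rpow_one_add_le_one_add_mul_self (s := -t) (by linarith) hβ.le h
    simpa [sub_eq_add_neg] using this

theorem rpow_succ_sub_bounds {β : ℝ} (hβ : 0 < β) (M : ℕ) :
    min 1 β * ((M + 1 : ℕ) : ℝ) ^ (β - 1) ≤ ((M + 1 : ℕ) : ℝ) ^ β - (M : ℝ) ^ β ∧
      ((M + 1 : ℕ) : ℝ) ^ β - (M : ℝ) ^ β ≤ max 1 β * ((M + 1 : ℕ) : ℝ) ^ (β - 1) := by
  have hx : (0:ℝ) < ((M + 1 : ℕ) : ℝ) := by positivity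
  set x : ℝ := ((M + 1 : ℕ) : ℝ) with hxd
  have hM : (M : ℝ) = x * (1 - x⁻¹) := by
    rw [mul_sub, mul_inv_cancel₀ hx.ne', hxd]
    push_cast
    ring
  have hx1 : x⁻¹ ≤ 1 := inv_le_one_of_one_le₀ (by rw [hxd]; push_cast; linarith [M.cast_nonneg (α := ℝ)])
  have hpow : x ^ (β - 1) = x ^ β * x⁻¹ := by
    rw [Real.rpow_sub_one hx.ne', div_eq_mul_inv]
  have hb := Real.rpow_pos_of_pos hx β
  rw [hM, Real.mul_rpow hx.le (by linarith), hpow]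
  have h1 := mul_le_mul_of_nonneg_left
    (one_sub_max_mul_le_rpow (β := β) (inv_nonneg.2 hx.le) hx1) hb.le
  have h2 := mul_le_mul_of_nonneg_left
    (rpow_le_one_sub_min_mul hβ (inv_nonneg.2 hx.le) hx1) hb.le
  constructor <;> nlinarith

theorem sum_Icc_rpow_bounds {β : ℝ} (hβ : 0 < β) (M : ℕ) :
    min 1 β * ∑ ν ∈ Finset.Icc 1 M, (ν : ℝ) ^ (β - 1) ≤ (M : ℝ) ^ β ∧
      (M : ℝ) ^ β ≤ max 1 β * ∑ ν ∈ Finset.Icc 1 M, (ν : ℝ) ^ (β - 1) := by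
  induction M with
  | zero => simp [Real.zero_rpow hβ.ne']
  | succ M ih =>
    rw [Finset.sum_Icc_succ_top (by omega), mul_add, mul_add]
    have h := rpow_succ_sub_bounds hβ M
    constructor <;> linarith [ih.1, ih.2, h.1, h.2]

/-- The total weight, in one variable, of the best approximations of order at most `n` that
involve the frequency `2^i`. -/
def weight (α : ℝ) (n i : ℕ) : ℝ :=
  ((n : ℝ) ^ (-α)) ^ 2 *
    ∑ ν ∈ Finset.Icc 1 (n+1), if ν - 1 < 2^i then (ν : ℝ) ^ (α*2 - 1) else 0

theorem weight_nonneg (α : ℝ) (n i : ℕ) : 0 ≤ weight α n i :=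
  mul_nonneg (sq_nonneg _) (Finset.sum_nonneg fun _ _ => by split_ifs <;> positivity)

theorem weight_bounds {α : ℝ} (hα : 0 < α) {n : ℕ} (hn : 1 ≤ n) (i : ℕ) :
    min 1 (α*2) * weight α n i ≤ (((min (n+1) (2^i) : ℕ) : ℝ) / n) ^ (α*2) ∧
      (((min (n+1) (2^i) : ℕ) : ℝ) / n) ^ (α*2) ≤ max 1 (α*2) * weight α n i := by
  have hn0 : (0:ℝ) < n := by exact_mod_cast hn
  have hs : ∑ ν ∈ Finset.Icc 1 (n+1), (if ν - 1 < 2^i then (ν : ℝ) ^ (α*2 - 1) else 0) =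
      ∑ ν ∈ Finset.Icc 1 (min (n+1) (2^i)), (ν : ℝ) ^ (α*2 - 1) := by
    rw [← Finset.sum_filter]
    congr 1
    ext ν
    simp only [Finset.mem_filter, Finset.mem_Icc, le_min_iff]
    omega
  have hd : (((min (n+1) (2^i) : ℕ) : ℝ) / n) ^ (α*2) =
      ((n : ℝ) ^ (-α)) ^ 2 * ((min (n+1) (2^i) : ℕ) : ℝ) ^ (α*2) := by
    rw [Real.div_rpow (Nat.cast_nonneg _) hn0.le, ← Real.rpow_natCast ((n:ℝ) ^ (-α)),
      ← Real.rpow_mul hn0.le, div_eq_inv_mul, ← Real.rpow_neg hn0.le]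
    congr 2
    push_cast
    ring
  have h := sum_Icc_rpow_bounds (β := α*2) (by linarith) (min (n+1) (2^i))
  have h1 := mul_le_mul_of_nonneg_left h.1 (sq_nonneg ((n:ℝ) ^ (-α)))
  have h2 := mul_le_mul_of_nonneg_left h.2 (sq_nonneg ((n:ℝ) ^ (-α)))
  rw [weight, hs, hd]
  constructor <;> linarith

theorem amp_sq (α h : ℝ) (i : ℕ) : amp α h i ^ 2 = |2 * sin (2^i * h / 2)| ^ (α*2) := by
  rw [amp, ← Real.rpow_natCast, ← Real.rpow_mul (abs_nonneg _)]
  norm_num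

theorem abs_two_mul_sin_le {n : ℕ} (hn : 1 ≤ n) {h : ℝ} (hh : |h| ≤ 1/(n:ℝ)) (i : ℕ) :
    |2 * sin (2^i * h / 2)| ≤ 2 * (((min (n+1) (2^i) : ℕ) : ℝ) / n) := by
  have hn0 : (0:ℝ) < n := by exact_mod_cast hn
  rw [abs_mul, abs_two]
  refine mul_le_mul_of_nonneg_left ?_ two_pos.le
  rcases min_choice (n+1) (2^i) with h' | h' <;> rw [h']
  · refine (abs_sin_le_one _).trans ((one_le_div hn0).2 ?_)
    push_cast
    linarith
  · refine (abs_sin_le_abs).trans ?_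
    rw [abs_div, abs_mul, abs_two, abs_of_pos (by positivity : (0:ℝ) < 2^i)]
    push_cast
    have : (2:ℝ)^i * |h| ≤ 2^i * (1/(n:ℝ)) := mul_le_mul_of_nonneg_left hh (by positivity)
    rw [mul_one_div] at this
    have h0 : 0 ≤ (2:ℝ)^i * |h| := by positivity
    linarith

theorem sin_sq_two_pow_mul_pi_div_three (k : ℕ) : sin (2^k * (π/3)) ^ 2 = 3/4 := by
  induction k with
  | zero => simp [sin_pi_div_three, div_pow]; norm_num
  | succ k ih =>
    rw [pow_succ' (2:ℝ), mul_assoc, sin_two_mul, mul_pow, mul_pow, cos_sq', ih]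
    norm_num

theorem exists_le_abs_two_mul_sin {n : ℕ} (hn : 1 ≤ n) : ∃ h : ℝ, |h| ≤ 1/(n:ℝ) ∧
    ∀ i : ℕ, ((min (n+1) (2^i) : ℕ) : ℝ) / n ≤ 12 * |2 * sin (2^i * h / 2)| := by
  have hn0 : (0:ℝ) < n := by exact_mod_cast hn
  obtain ⟨j, hj1, hj2⟩ : ∃ j : ℕ, 3 * n ≤ 2^j ∧ 2^j ≤ 6 * n := by
    refine ⟨Nat.clog 2 (3*n), Nat.le_pow_clog one_lt_two _, ?_⟩
    have h1 := Nat.pow_pred_clog_lt_self one_lt_two (x := 3*n) (by omega)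
    have h2 : 0 < Nat.clog 2 (3*n) := Nat.clog_pos one_lt_two (by omega)
    obtain ⟨k, hk⟩ := Nat.exists_eq_succ_of_ne_zero h2.ne'
    rw [hk] at h1 ⊢
    simp only [Nat.succ_eq_add_one, Nat.pred_succ, pow_succ] at h1 ⊢
    omega
  have hj1' : 3 * (n:ℝ) ≤ 2^j := by exact_mod_cast hj1
  have hj2' : (2:ℝ)^j ≤ 6 * n := by exact_mod_cast hj2
  have hpj : (0:ℝ) < 2^j := by positivity
  refine ⟨2*π/3/2^j, ?_, fun i => ?_⟩
  · rw [abs_of_pos (by positivity), div_le_div_iff₀ hpj hn0]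
    nlinarith [pi_lt_d2]
  · rcases le_or_gt j i with hij | hij
    · obtain ⟨k, rfl⟩ := Nat.exists_eq_add_of_le hij
      have he : (2:ℝ)^(j+k) * (2*π/3/2^j) / 2 = 2^k * (π/3) := by
        rw [pow_add]
        field_simp
      rw [he, div_le_iff₀ hn0]
      have hs := sin_sq_two_pow_mul_pi_div_three k
      have h1 : 1/2 ≤ |sin (2^k * (π/3))| := by
        rw [← sq_abs] at hs
        nlinarith [abs_nonneg (sin (2^k * (π/3)))]
      have h2 : ((min (n+1) (2^(j+k)) : ℕ) : ℝ) ≤ n + 1 := by exact_mod_cast min_le_left _ _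
      have hn1 : (1:ℝ) ≤ n := by exact_mod_cast hn
      rw [abs_mul, abs_two]
      nlinarith
    · have he : (2:ℝ)^i * (2*π/3/2^j) / 2 = 2^i/2^j * (π/3) := by
        field_simp
      have hr : (2:ℝ)^i/2^j ≤ 1 := by
        rw [div_le_one hpj]
        exact pow_le_pow_right₀ one_le_two hij.le
      have hr0 : (0:ℝ) < 2^i/2^j := by positivity
      have hsin := mul_le_sin (x := 2^i/2^j * (π/3)) (by positivity) (by nlinarith [pi_pos])
      have hc : 2/π * (2^i/2^j * (π/3)) = 2/3 * ((2:ℝ)^i/2^j) := by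
        field_simp
      rw [hc] at hsin
      rw [he]
      have h2 : ((min (n+1) (2^i) : ℕ) : ℝ) ≤ 2^i := by exact_mod_cast min_le_right _ _
      have h3 : ((min (n+1) (2^i) : ℕ) : ℝ) / n ≤ 6 * (2^i/2^j) := by
        rw [← mul_div_assoc, div_le_div_iff₀ hn0 hpj]
        nlinarith [pow_pos (two_pos (α := ℝ)) i]
      refine h3.trans ?_
      have := le_abs_self (2 * sin (2^i/2^j * (π/3)))
      linarith

/-- The squared amplitudes of differences of step at most `1/n` are controlled by the weights,
and a suitable step attains them up to a constant. -/
theorem exists_amp_sq_equiv_weight {α : ℝ} (hα : 0 < α) : ∃ K : ℝ, 0 < K ∧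
    ∀ n : ℕ, 1 ≤ n → (∀ h : ℝ, |h| ≤ 1/(n:ℝ) → ∀ i, amp α h i ^ 2 ≤ K * weight α n i) ∧
      ∃ h : ℝ, |h| ≤ 1/(n:ℝ) ∧ ∀ i, weight α n i ≤ K * amp α h i ^ 2 := by
  have hmin : 0 < min 1 (α*2) := lt_min one_pos (by linarith)
  refine ⟨max (2 ^ (α*2) * max 1 (α*2)) (12 ^ (α*2) / min 1 (α*2)), by positivity,
    fun n hn => ⟨fun h hh i => ?_, ?_⟩⟩
  · refine le_trans ?_ (mul_le_mul_of_nonneg_right (le_max_left _ _) (weight_nonneg α n i))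
    rw [amp_sq, mul_assoc]
    refine (Real.rpow_le_rpow (abs_nonneg _) (abs_two_mul_sin_le hn hh i) (by linarith)).trans ?_
    rw [Real.mul_rpow two_pos.le (by positivity)]
    exact mul_le_mul_of_nonneg_left (weight_bounds hα hn i).2 (by positivity)
  · obtain ⟨h, hh, hle⟩ := exists_le_abs_two_mul_sin hn
    refine ⟨h, hh, fun i => ?_⟩
    refine le_trans ?_ (mul_le_mul_of_nonneg_right (le_max_right _ _) (sq_nonneg _))
    rw [amp_sq, div_mul_eq_mul_div, le_div_iff₀' hmin,
      ← Real.mul_rpow (by norm_num) (abs_nonneg _)]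
    exact (weight_bounds hα hn i).1.trans
      (Real.rpow_le_rpow (by positivity) (hle i) (by linarith))

/-- The `ℓ_2` form of the weighted sum of best angular approximations. -/
def weightedSum (α₁ α₂ : ℝ) (n₁ n₂ : ℕ) (lam : ℕ → ℕ → ℝ) : ℝ≥0∞ :=
  ∑' z : ℕ × ℕ, ENNReal.ofReal (lam z.1 z.2 ^ 2 * weight α₁ n₁ z.1 * weight α₂ n₂ z.2)

theorem weightedSum_eq (α₁ α₂ : ℝ) (n₁ n₂ : ℕ) (lam : ℕ → ℕ → ℝ) :
    ENNReal.ofReal ((n₁:ℝ) ^ (-α₁) * (n₂:ℝ) ^ (-α₂)) ^ 2 *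
      ∑ ν₁ ∈ Finset.Icc 1 (n₁+1), ∑ ν₂ ∈ Finset.Icc 1 (n₂+1),
        ENNReal.ofReal ((ν₁:ℝ) ^ (α₁*2-1) * (ν₂:ℝ) ^ (α₂*2-1)) *
          sqSum (highPart (ν₁-1) (ν₂-1) lam) = weightedSum α₁ α₂ n₁ n₂ lam := by
  have ha : 0 ≤ (n₁:ℝ) ^ (-α₁) * (n₂:ℝ) ^ (-α₂) := by positivity
  simp only [sqSum, weightedSum, ← ENNReal.tsum_mul_left, ← ENNReal.ofReal_pow ha,
    ← Summable.tsum_finsetSum fun _ _ => ENNReal.summable]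
  refine tsum_congr fun z => ?_
  have hw : ∀ ν₁ ν₂ : ℕ, 0 ≤ (ν₁:ℝ) ^ (α₁*2-1) * (ν₂:ℝ) ^ (α₂*2-1) := fun _ _ => by positivity
  have ht : ∀ ν₁ ν₂ : ℕ, 0 ≤ (ν₁:ℝ) ^ (α₁*2-1) * (ν₂:ℝ) ^ (α₂*2-1) *
    highPart (ν₁-1) (ν₂-1) lam z.1 z.2 ^ 2 := fun _ _ => mul_nonneg (hw _ _) (sq_nonneg _)
  simp only [← ENNReal.ofReal_mul (hw _ _)]
  simp only [← ENNReal.ofReal_sum_of_nonneg fun _ _ => ht _ _]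
  rw [← ENNReal.ofReal_sum_of_nonneg fun _ _ => Finset.sum_nonneg fun _ _ => ht _ _,
    ← ENNReal.ofReal_mul (sq_nonneg _)]
  congr 1
  calc _ = ((n₁:ℝ) ^ (-α₁) * (n₂:ℝ) ^ (-α₂)) ^ 2 * (lam z.1 z.2 ^ 2 *
      ∑ ν₁ ∈ Finset.Icc 1 (n₁+1), ∑ ν₂ ∈ Finset.Icc 1 (n₂+1),
        (if ν₁ - 1 < 2^z.1 then (ν₁ : ℝ) ^ (α₁*2 - 1) else 0) *
          (if ν₂ - 1 < 2^z.2 then (ν₂ : ℝ) ^ (α₂*2 - 1) else 0)) := by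
        simp only [Finset.mul_sum]
        refine Finset.sum_congr rfl fun ν₁ _ => Finset.sum_congr rfl fun ν₂ _ => ?_
        by_cases h1 : ν₁ - 1 < 2^z.1 <;> by_cases h2 : ν₂ - 1 < 2^z.2 <;>
          simp only [highPart, h1, h2, and_self, and_false, false_and, if_true, if_false] <;>
          ring
    _ = _ := by
        rw [← Finset.sum_mul_sum, weight, weight]
        ring

theorem sqrt_const_mul_rpow_half (c : ℝ≥0∞) (S : ℝ≥0∞) :
    (c ^ 2 * S) ^ (1/2 : ℝ) = c * S ^ (1/2 : ℝ) := by
  rw [ENNReal.mul_rpow_of_nonneg _ _ (by norm_num), ← ENNReal.rpow_natCast, ← ENNReal.rpow_mul]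
  norm_num

theorem exists_Ysum_equiv {p : ℝ} (hp : 1 < p) (α₁ α₂ : ℝ) : ∃ C : ℝ, 0 < C ∧
    ∀ (f : ℝ → ℝ → ℝ) (lam : ℕ → ℕ → ℝ), InLambdaClass p f lam → ∀ n₁ n₂ : ℕ,
      Ysum p α₁ α₂ 2 n₁ n₂ f ≤
        ENNReal.ofReal C * weightedSum α₁ α₂ n₁ n₂ lam ^ (1/2 : ℝ) ∧
      weightedSum α₁ α₂ n₁ n₂ lam ^ (1/2 : ℝ) ≤
        ENNReal.ofReal C * Ysum p α₁ α₂ 2 n₁ n₂ f := by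
  obtain ⟨C, hC, h⟩ := exists_Yapprox_equiv hp
  refine ⟨C, hC, fun f lam hf n₁ n₂ => ?_⟩
  have hsq : ∀ S : ℝ≥0∞, (S ^ (1/2 : ℝ)) ^ 2 = S := fun S => by
    rw [← ENNReal.rpow_natCast, ← ENNReal.rpow_mul]
    norm_num
  have hY : ∀ m₁ m₂, Yapprox p m₁ m₂ f ^ 2 ≤ ENNReal.ofReal C ^ 2 *
      sqSum (highPart m₁ m₂ lam) ∧
      sqSum (highPart m₁ m₂ lam) ≤ ENNReal.ofReal C ^ 2 * Yapprox p m₁ m₂ f ^ 2 := by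
    intro m₁ m₂
    constructor
    · rw [← hsq (sqSum _), ← mul_pow]
      exact pow_le_pow_left' (h f lam hf m₁ m₂).1 2
    · rw [← hsq (sqSum _), ← mul_pow]
      exact pow_le_pow_left' (h f lam hf m₁ m₂).2 2
  rw [Ysum, ← weightedSum_eq, sqrt_const_mul_rpow_half]
  simp only [ENNReal.rpow_two]
  rw [mul_left_comm, mul_left_comm (ENNReal.ofReal C), ← sqrt_const_mul_rpow_half (ENNReal.ofReal C),
    ← sqrt_const_mul_rpow_half (ENNReal.ofReal C)]
  simp only [Finset.mul_sum, mul_left_comm (ENNReal.ofReal C ^ 2)]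
  constructor
  · gcongr
    exact (hY _ _).1
  · gcongr
    exact (hY _ _).2

theorem sqSum_amp_le {K₁ K₂ : ℝ} (hK₁ : 0 < K₁) (hK₂ : 0 < K₂) {lam : ℕ → ℕ → ℝ} {α₁ α₂ h₁ h₂ : ℝ}
    {n₁ n₂ : ℕ} (H₁ : ∀ i, amp α₁ h₁ i ^ 2 ≤ K₁ * weight α₁ n₁ i)
    (H₂ : ∀ i, amp α₂ h₂ i ^ 2 ≤ K₂ * weight α₂ n₂ i) :
    sqSum (fun i j => lam i j * amp α₁ h₁ i * amp α₂ h₂ j) ≤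
      ENNReal.ofReal (K₁ * K₂) * weightedSum α₁ α₂ n₁ n₂ lam := by
  rw [sqSum, weightedSum, ← ENNReal.tsum_mul_left]
  refine ENNReal.tsum_le_tsum fun z => ?_
  rw [← ENNReal.ofReal_mul (by positivity)]
  refine ENNReal.ofReal_le_ofReal ?_
  calc _ = lam z.1 z.2 ^ 2 * (amp α₁ h₁ z.1 ^ 2 * amp α₂ h₂ z.2 ^ 2) := by ring
    _ ≤ lam z.1 z.2 ^ 2 * ((K₁ * weight α₁ n₁ z.1) * (K₂ * weight α₂ n₂ z.2)) := by
      refine mul_le_mul_of_nonneg_left (mul_le_mul (H₁ _) (H₂ _) (sq_nonneg _)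
        (mul_nonneg hK₁.le (weight_nonneg _ _ _))) (sq_nonneg _)
    _ = _ := by ring

theorem weightedSum_le {K₁ K₂ : ℝ} (hK₁ : 0 < K₁) (hK₂ : 0 < K₂) {lam : ℕ → ℕ → ℝ}
    {α₁ α₂ h₁ h₂ : ℝ} {n₁ n₂ : ℕ} (H₁ : ∀ i, weight α₁ n₁ i ≤ K₁ * amp α₁ h₁ i ^ 2)
    (H₂ : ∀ i, weight α₂ n₂ i ≤ K₂ * amp α₂ h₂ i ^ 2) :
    weightedSum α₁ α₂ n₁ n₂ lam ≤ ENNReal.ofReal (K₁ * K₂) *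
      sqSum (fun i j => lam i j * amp α₁ h₁ i * amp α₂ h₂ j) := by
  rw [sqSum, weightedSum, ← ENNReal.tsum_mul_left]
  refine ENNReal.tsum_le_tsum fun z => ?_
  rw [← ENNReal.ofReal_mul (by positivity)]
  refine ENNReal.ofReal_le_ofReal ?_
  calc _ = lam z.1 z.2 ^ 2 * (weight α₁ n₁ z.1 * weight α₂ n₂ z.2) := by ring
    _ ≤ lam z.1 z.2 ^ 2 * ((K₁ * amp α₁ h₁ z.1 ^ 2) * (K₂ * amp α₂ h₂ z.2 ^ 2)) := by
      refine mul_le_mul_of_nonneg_left (mul_le_mul (H₁ _) (H₂ _) (weight_nonneg _ _ _)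
        (by positivity)) (sq_nonneg _)
    _ = _ := by ring

/-- For `f ∈ Λ_p`, the mixed modulus of smoothness is equivalent to the weighted
sum (with exponent `2`) of angular approximations (Theorem 9.3). -/
theorem modulus_vs_angular_Lambda (p α₁ α₂ : ℝ) (hp : 1 < p)
    (hα₁ : 0 < α₁) (hα₂ : 0 < α₂) :
    ∃ C : ℝ, 0 < C ∧ ∀ (f : ℝ → ℝ → ℝ) (lam : ℕ → ℕ → ℝ) (n₁ n₂ : ℕ),
      1 ≤ n₁ → 1 ≤ n₂ → InLambdaClass p f lam →
      mixedMod p α₁ α₂ (1/(n₁:ℝ)) (1/(n₂:ℝ)) f ≤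
          ENNReal.ofReal C * Ysum p α₁ α₂ 2 n₁ n₂ f ∧
      Ysum p α₁ α₂ 2 n₁ n₂ f ≤
          ENNReal.ofReal C * mixedMod p α₁ α₂ (1/(n₁:ℝ)) (1/(n₂:ℝ)) f := by
  obtain ⟨A, hA, hdiff⟩ := exists_diff_equiv hp hα₁ hα₂
  obtain ⟨B, hB, hY⟩ := exists_Ysum_equiv hp α₁ α₂
  obtain ⟨K₁, hK₁, hw₁⟩ := exists_amp_sq_equiv_weight hα₁
  obtain ⟨K₂, hK₂, hw₂⟩ := exists_amp_sq_equiv_weight hα₂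
  have hhalf : (0:ℝ) ≤ 1/2 := by norm_num
  have hK : ∀ S : ℝ≥0∞, (ENNReal.ofReal (K₁ * K₂) * S) ^ (1/2 : ℝ) =
      ENNReal.ofReal ((K₁ * K₂) ^ (1/2 : ℝ)) * S ^ (1/2 : ℝ) := fun S => by
    rw [ENNReal.mul_rpow_of_nonneg _ _ hhalf, ENNReal.ofReal_rpow_of_nonneg (by positivity) hhalf]
  have hC : ENNReal.ofReal (A * (K₁ * K₂) ^ (1/2 : ℝ) * B) =
      ENNReal.ofReal A * (ENNReal.ofReal ((K₁ * K₂) ^ (1/2 : ℝ)) * ENNReal.ofReal B) := by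
    rw [ENNReal.ofReal_mul (by positivity), ENNReal.ofReal_mul hA.le, mul_assoc]
  refine ⟨A * (K₁ * K₂) ^ (1/2 : ℝ) * B, by positivity, fun f lam n₁ n₂ hn₁ hn₂ hf => ⟨?_, ?_⟩⟩
  · refine iSup₂_le fun h₁ hh₁ => iSup₂_le fun h₂ hh₂ => ((hdiff f lam hf h₁ h₂).1).trans ?_
    rw [hC, mul_assoc, mul_assoc]
    refine mul_le_mul_right ?_ _
    refine (ENNReal.rpow_le_rpow (sqSum_amp_le hK₁ hK₂ ((hw₁ n₁ hn₁).1 h₁ hh₁)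
      ((hw₂ n₂ hn₂).1 h₂ hh₂)) hhalf).trans ?_
    rw [hK]
    exact mul_le_mul_right (hY f lam hf n₁ n₂).2 _
  · obtain ⟨h₁, hh₁, H₁⟩ := (hw₁ n₁ hn₁).2
    obtain ⟨h₂, hh₂, H₂⟩ := (hw₂ n₂ hn₂).2
    have hmod : Lp2Norm p (diffX α₁ h₁ (diffY α₂ h₂ f)) ≤
        mixedMod p α₁ α₂ (1/(n₁:ℝ)) (1/(n₂:ℝ)) f :=
      (le_iSup₂_of_le h₂ hh₂ le_rfl).trans (le_iSup₂ (f := fun (h₁ : ℝ)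
        (_ : |h₁| ≤ 1/(n₁:ℝ)) => ⨆ (h₂ : ℝ) (_ : |h₂| ≤ 1/(n₂:ℝ)),
          Lp2Norm p (diffX α₁ h₁ (diffY α₂ h₂ f))) h₁ hh₁)
    calc _ ≤ ENNReal.ofReal B * weightedSum α₁ α₂ n₁ n₂ lam ^ (1/2 : ℝ) := (hY f lam hf n₁ n₂).1
      _ ≤ ENNReal.ofReal B * (ENNReal.ofReal ((K₁ * K₂) ^ (1/2 : ℝ)) *
          (ENNReal.ofReal A * mixedMod p α₁ α₂ (1/(n₁:ℝ)) (1/(n₂:ℝ)) f)) := by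
        refine mul_le_mul_right ?_ _
        refine (ENNReal.rpow_le_rpow (weightedSum_le hK₁ hK₂ H₁ H₂) hhalf).trans ?_
        rw [hK]
        exact mul_le_mul_right ((hdiff f lam hf h₁ h₂).2.trans (mul_le_mul_right hmod _)) _
      _ = _ := by
        rw [hC]
        ring

end
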